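/- There is no binary linear code of length 31, dimension 13, and minimum distance at least 10. -/

import Mathlib

namespace BinaryCode

/-- The nontrivial additive character of the field with two elements. -/
def sign (x : ZMod 2) : ℤ := if x = 0 then 1 else -1

@[simp] lemma sign_zero : sign 0 = 1 := rfl

lemma sign_add : ∀ x y : ZMod 2, sign (x + y) = sign x * sign y := by decide

lemma sign_sum {ι : Type*} (s : Finset ι) (f : ι → ZMod 2) :
    sign (∑ i ∈ s, f i) = ∏ i ∈ s, sign (f i) := by
  classical
  induction s using Finset.induction_on with
  | empty => simp
  | insert a s ha ih => rw [Finset.sum_insert ha, Finset.prod_insert ha, sign_add, ih]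

/-- A linear functional on a finite binary space has character sum `|V|` or `0`. -/
lemma sum_sign_linear {n : ℕ} (C : Submodule (ZMod 2) (Fin n → ZMod 2)) [Fintype C]
    (f : (Fin n → ZMod 2) →ₗ[ZMod 2] ZMod 2) [Decidable (∀ c ∈ C, f c = 0)] :
    ∑ c : C, sign (f c) = if ∀ c ∈ C, f c = 0 then (Fintype.card C : ℤ) else 0 := by
  split_ifs with h
  · rw [Finset.sum_congr rfl (fun c _ => by rw [h c c.2, sign_zero])]
    simp
  · push Not at h
    obtain ⟨d, hd, hfd⟩ := h
    have h1 : sign (f d) = -1 := by simp [sign, hfd]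
    have h2 : ∑ c : C, sign (f c) = ∑ c : C, sign (f (c + (⟨d, hd⟩ : C) : C)) :=
      (Fintype.sum_equiv (Equiv.addRight (⟨d, hd⟩ : C)) _ _ (fun c => rfl)).symm
    simp only [Submodule.coe_add, map_add, sign_add, h1] at h2
    rw [← Finset.sum_mul] at h2
    linarith

/-- The Krawtchouk polynomials: coefficients of `(1 - X) ^ w * (1 + X) ^ (n - w)`. -/
def kraw (n j w : ℕ) : ℤ :=
  ∑ i ∈ Finset.range (j + 1), (-1) ^ i * (w.choose i : ℤ) * ((n - w).choose (j - i) : ℤ)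

open Polynomial in
lemma coeff_kraw (n j w : ℕ) :
    ((1 - X : ℤ[X]) ^ w * (1 + X) ^ (n - w)).coeff j = kraw n j w := by
  have h : ∀ i, ((1 - X : ℤ[X]) ^ w).coeff i = (-1) ^ i * (w.choose i : ℤ) := by
    intro i
    have : (1 - X : ℤ[X]) ^ w = ((1 + X) ^ w).comp (C (-1) * X) := by
      simp [sub_eq_add_neg]
    rw [this, comp_C_mul_X_coeff, coeff_one_add_X_pow, mul_comm]
  rw [coeff_mul, Finset.Nat.sum_antidiagonal_eq_sum_range_succ_mk, kraw]
  refine Finset.sum_congr rfl fun i _ => ?_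
  rw [h, coeff_one_add_X_pow]

open Polynomial in
lemma sum_prod_sign {n : ℕ} (c : Fin n → ZMod 2) (j : ℕ) :
    ∑ S ∈ Finset.powersetCard j Finset.univ, ∏ i ∈ S, sign (c i) = kraw n j (hammingNorm c) := by
  classical
  have h1 : ∏ i, (1 + C (sign (c i)) * X : ℤ[X]) =
      (1 - X) ^ hammingNorm c * (1 + X) ^ (n - hammingNorm c) := by
    rw [← Finset.prod_filter_mul_prod_filter_not Finset.univ (fun i => c i ≠ 0)]
    congr 1
    · rw [Finset.prod_congr rfl (g := fun _ => (1 - X : ℤ[X])), Finset.prod_const]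
      · rfl
      · intro i hi
        have : sign (c i) = -1 := by simp_all [sign]
        rw [this]; simp [sub_eq_add_neg]
    · rw [Finset.prod_congr rfl (g := fun _ => (1 + X : ℤ[X])), Finset.prod_const]
      · congr 1
        have := Finset.card_filter_add_card_filter_not
            (s := (Finset.univ : Finset (Fin n))) (fun i => c i ≠ 0)
        simp only [Finset.card_univ, Fintype.card_fin] at this
        simp only [hammingNorm]
        omega
      · intro i hi
        have : c i = 0 := by simpa using hi
        rw [this]; simp
  have h2 : ∏ i, (1 + C (sign (c i)) * X : ℤ[X]) =
      ∑ S ∈ Finset.univ.powerset, C (∏ i ∈ S, sign (c i)) * X ^ S.card := by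
    rw [Finset.prod_one_add]
    refine Finset.sum_congr rfl fun S _ => ?_
    rw [Finset.prod_mul_distrib, Finset.prod_const, map_prod]
  rw [← coeff_kraw, ← h1, h2, finsetSum_coeff, Finset.powersetCard_eq_filter, Finset.sum_filter]
  refine Finset.sum_congr rfl fun S _ => ?_
  rw [coeff_C_mul_X_pow]
  simp [eq_comm]

/-- A set of coordinates is dual to `C` when its indicator is orthogonal to `C`. -/
def IsDual {n : ℕ} (C : Submodule (ZMod 2) (Fin n → ZMod 2)) (S : Finset (Fin n)) : Prop :=
  ∀ c ∈ C, ∑ i ∈ S, c i = 0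

open Classical in
/-- The number of dual sets of size `j`. -/
noncomputable def dualCount {n : ℕ} (C : Submodule (ZMod 2) (Fin n → ZMod 2)) (j : ℕ) : ℕ :=
  ((Finset.powersetCard j Finset.univ).filter (IsDual C)).card

lemma macWilliams {n : ℕ} (C : Submodule (ZMod 2) (Fin n → ZMod 2)) [Fintype C] (j : ℕ) :
    ∑ c : C, kraw n j (hammingNorm (c : Fin n → ZMod 2)) = Fintype.card C * dualCount C j := by
  classical
  simp_rw [← sum_prod_sign]
  rw [Finset.sum_comm, dualCount, Finset.card_filter]
  push_cast
  rw [Finset.mul_sum]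
  refine Finset.sum_congr rfl fun S _ => ?_
  have := sum_sign_linear C (∑ i ∈ S, LinearMap.proj i)
  simp only [LinearMap.sum_apply, LinearMap.proj_apply] at this
  simp_rw [← sign_sum]
  rw [this]
  by_cases h : ∀ c ∈ C, ∑ d ∈ S, c d = 0
  · rw [if_pos h, if_pos (show IsDual C S from h)]; simp
  · rw [if_neg h, if_neg (show ¬ IsDual C S from h)]; simp

lemma dualCount_zero {n : ℕ} (C : Submodule (ZMod 2) (Fin n → ZMod 2)) : dualCount C 0 = 1 := by
  classical
  rw [dualCount, Finset.powersetCard_zero, Finset.filter_true_of_mem]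
  · simp
  · intro S hS
    simp only [Finset.mem_singleton] at hS
    simp [hS, IsDual]

lemma dualCount_eq_zero {n : ℕ} {C : Submodule (ZMod 2) (Fin n → ZMod 2)} {j : ℕ}
    (h : ∀ S : Finset (Fin n), S.card = j → ¬ IsDual C S) : dualCount C j = 0 := by
  classical
  rw [dualCount, Finset.card_eq_zero, Finset.filter_eq_empty_iff]
  intro S hS
  exact h S (Finset.mem_powersetCard.1 hS).2

/-- Delsarte's linear programming inequality. -/
lemma delsarte {n : ℕ} (C : Submodule (ZMod 2) (Fin n → ZMod 2)) [Fintype C] (J : ℕ) (b : ℕ → ℤ)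
    (hb : ∀ j, 1 ≤ j → j ≤ J → 0 ≤ b j ∨ ∀ S : Finset (Fin n), S.card = j → ¬ IsDual C S) :
    Fintype.card C * b 0 ≤
      ∑ c : C, ∑ j ∈ Finset.range (J + 1), b j * kraw n j (hammingNorm (c : Fin n → ZMod 2)) := by
  rw [Finset.sum_comm]
  simp_rw [← Finset.mul_sum, macWilliams]
  rw [Finset.sum_range_succ']
  rw [dualCount_zero]
  have : 0 ≤ ∑ k ∈ Finset.range J, b (k + 1) * ((Fintype.card C : ℤ) * dualCount C (k + 1)) := by
    refine Finset.sum_nonneg fun k hk => ?_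
    rcases hb (k + 1) (by omega) (by simpa using hk) with h | h
    · positivity
    · rw [dualCount_eq_zero h]; simp
  push_cast
  linarith

lemma delsarte_eq {n : ℕ} (C : Submodule (ZMod 2) (Fin n → ZMod 2)) [Fintype C] (J : ℕ) (b : ℕ → ℤ)
    (hb : ∀ S : Finset (Fin n), 1 ≤ S.card → S.card ≤ J → ¬ IsDual C S) :
    ∑ c : C, ∑ j ∈ Finset.range (J + 1), b j * kraw n j (hammingNorm (c : Fin n → ZMod 2)) =
    Fintype.card C * b 0 := by
  rw [Finset.sum_comm]
  simp_rw [← Finset.mul_sum, macWilliams]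
  rw [Finset.sum_range_succ', dualCount_zero, Finset.sum_eq_zero]
  · push_cast; ring
  · intro k hk
    rw [dualCount_eq_zero]
    · simp
    · intro S hS
      exact hb S (by omega) (by have := Finset.mem_range.1 hk; omega)

lemma norm_eq_sum {n : ℕ} (x : Fin n → ZMod 2) :
    hammingNorm x = ∑ i, if x i ≠ 0 then 1 else 0 := by
  rw [hammingNorm, Finset.card_filter]

lemma norm_add_add {n : ℕ} (x y : Fin n → ZMod 2) :
    hammingNorm (x + y) + 2 * hammingNorm (x * y) = hammingNorm x + hammingNorm y := by
  simp only [norm_eq_sum, Finset.mul_sum, ← Finset.sum_add_distrib]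
  refine Finset.sum_congr rfl fun i _ => ?_
  have : ∀ a b : ZMod 2, (if a + b ≠ 0 then 1 else 0) + 2 * (if a * b ≠ 0 then 1 else 0) =
      (if a ≠ 0 then 1 else 0) + (if b ≠ 0 then 1 else 0) := by decide
  exact this _ _

lemma norm_cast_eq {n : ℕ} (x : Fin n → ZMod 2) : (hammingNorm x : ZMod 2) = ∑ i, x i := by
  rw [norm_eq_sum]
  push_cast
  refine Finset.sum_congr rfl fun i _ => ?_
  have : ∀ a : ZMod 2, (if a ≠ 0 then 1 else 0) = a := by decide
  exact this _

lemma even_norm_iff {n : ℕ} (x : Fin n → ZMod 2) : Even (hammingNorm x) ↔ ∑ i, x i = 0 := by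
  rw [← norm_cast_eq, ZMod.natCast_eq_zero_iff_even]

lemma sign_natCast (m : ℕ) : sign (m : ZMod 2) = (-1) ^ m := by
  induction m with
  | zero => simp
  | succ m ih =>
    push_cast
    rw [sign_add, ih, pow_succ]
    rfl

/-- The sign `(-1) ^ (wt x / 2)`, a quadratic character on even words. -/
def quadSign {n : ℕ} (x : Fin n → ZMod 2) : ℤ := (-1) ^ (hammingNorm x / 2)

lemma quadSign_add {n : ℕ} {x y : Fin n → ZMod 2} (hx : Even (hammingNorm x))
    (hy : Even (hammingNorm y)) :
    quadSign (x + y) = quadSign x * quadSign y * sign (∑ i, x i * y i) := by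
  have h := norm_add_add x y
  have h2 : ∑ i, x i * y i = (hammingNorm (x * y) : ZMod 2) := by rw [norm_cast_eq]; rfl
  rw [h2, sign_natCast]
  obtain ⟨a, ha⟩ := hx
  obtain ⟨b, hb⟩ := hy
  simp only [quadSign]
  have e1 : hammingNorm x / 2 = a := by omega
  have e2 : hammingNorm y / 2 = b := by omega
  obtain ⟨m, hm⟩ : ∃ m, m = hammingNorm (x * y) := ⟨_, rfl⟩
  have e3 : a + b = hammingNorm (x + y) / 2 + m := by omega
  rw [e1, e2, ← hm, ← pow_add, e3, pow_add, mul_assoc, ← pow_add, ← two_mul,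
    (even_two_mul m).neg_one_pow, mul_one]

/-- The intersection of a code with its dual. -/
def hull {n : ℕ} (C : Submodule (ZMod 2) (Fin n → ZMod 2)) :
    Submodule (ZMod 2) (Fin n → ZMod 2) where
  carrier := {z | z ∈ C ∧ ∀ c ∈ C, ∑ i, c i * z i = 0}
  zero_mem' := ⟨C.zero_mem, by simp⟩
  add_mem' := fun ha hb => ⟨C.add_mem ha.1 hb.1, fun c hc => by
    simp [mul_add, Finset.sum_add_distrib, ha.2 c hc, hb.2 c hc]⟩
  smul_mem' := fun a x hx => ⟨C.smul_mem a hx.1, fun c hc => by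
    have := hx.2 c hc
    simp only [Pi.smul_apply, smul_eq_mul, mul_left_comm _ a, ← Finset.mul_sum, this, mul_zero]⟩

lemma card_eq_two_pow {n : ℕ} (C : Submodule (ZMod 2) (Fin n → ZMod 2)) [Fintype C] :
    Fintype.card C = 2 ^ Module.finrank (ZMod 2) C := by
  rw [Module.card_eq_pow_finrank (K := ZMod 2), ZMod.card]

lemma sq_sum_quadSign {n : ℕ} (C : Submodule (ZMod 2) (Fin n → ZMod 2)) [Fintype C]
    [Fintype (hull C)] (hC : ∀ c ∈ C, Even (hammingNorm c)) :
    (∑ c : C, quadSign (c : Fin n → ZMod 2)) ^ 2 =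
      Fintype.card C * ∑ z : hull C, quadSign (z : Fin n → ZMod 2) := by
  classical
  have key : ∀ x z : C, quadSign (x : Fin n → ZMod 2) * quadSign ((z + x : C) : Fin n → ZMod 2) =
      quadSign (z : Fin n → ZMod 2) * sign (∑ i, (z : Fin n → ZMod 2) i * (x : Fin n → ZMod 2) i)
          := by
    intro x z
    rw [Submodule.coe_add, quadSign_add (hC _ z.2) (hC _ x.2)]
    have : quadSign (x : Fin n → ZMod 2) * quadSign (x : Fin n → ZMod 2) = 1 := by
      rw [quadSign, ← pow_add, ← two_mul, (even_two_mul _).neg_one_pow]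
    linear_combination (quadSign (z : Fin n → ZMod 2) *
      sign (∑ i, (z : Fin n → ZMod 2) i * (x : Fin n → ZMod 2) i)) * this
  have h1 : (∑ c : C, quadSign (c : Fin n → ZMod 2)) ^ 2 =
      ∑ z : C, quadSign (z : Fin n → ZMod 2) *
        ∑ x : C, sign (∑ i, (z : Fin n → ZMod 2) i * (x : Fin n → ZMod 2) i) := by
    rw [sq, Finset.sum_mul_sum]
    simp_rw [Finset.mul_sum, ← key]
    rw [Finset.sum_comm (s := (Finset.univ : Finset C)) (t := (Finset.univ : Finset C))
      (f := fun z x : C => quadSign (x : Fin n → ZMod 2) *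
        quadSign ((z + x : C) : Fin n → ZMod 2))]
    refine Finset.sum_congr rfl fun x _ => ?_
    exact (Fintype.sum_equiv (Equiv.addRight x) (fun z : C => quadSign (x : Fin n → ZMod 2) *
      quadSign ((z + x : C) : Fin n → ZMod 2)) (fun z : C => quadSign (x : Fin n → ZMod 2) *
      quadSign (z : Fin n → ZMod 2)) (fun z => rfl)).symm
  have h2 : ∀ z : C, ∑ x : C, sign (∑ i, (z : Fin n → ZMod 2) i * (x : Fin n → ZMod 2) i) =
      if (z : Fin n → ZMod 2) ∈ hull C then (Fintype.card C : ℤ) else 0 := by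
    intro z
    have := sum_sign_linear C (∑ i, (z : Fin n → ZMod 2) i •
      (LinearMap.proj i : (Fin n → ZMod 2) →ₗ[ZMod 2] ZMod 2))
    simp only [LinearMap.sum_apply, LinearMap.smul_apply, LinearMap.proj_apply, smul_eq_mul] at this
    rw [this]
    have e : (∀ c ∈ C, ∑ i, (z : Fin n → ZMod 2) i * c i = 0) ↔ (z : Fin n → ZMod 2) ∈ hull C := by
      simp only [mul_comm]
      exact ⟨fun h => ⟨z.2, h⟩, fun h => h.2⟩
    simp only [e]
  rw [h1]
  simp_rw [h2, mul_ite, mul_zero]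
  rw [← Finset.sum_filter, Finset.mul_sum]
  refine Finset.sum_bij (fun z hz => ⟨z, (Finset.mem_filter.1 hz).2⟩) ?_ ?_ ?_ ?_
  · simp
  · intro a _ b _ h
    exact Subtype.ext (congrArg (fun t : hull C => (t : Fin n → ZMod 2)) h)
  · intro b _
    exact ⟨⟨b, b.2.1⟩, by simp, rfl⟩
  · intro a _
    ring

lemma quadSign_eq {n : ℕ} (x : Fin n → ZMod 2) : quadSign x = 1 ∨ quadSign x = -1 :=
  neg_one_pow_eq_or ℤ _

lemma sq_sum_quadSign_eq {n : ℕ} (C : Submodule (ZMod 2) (Fin n → ZMod 2)) [Fintype C]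
    (hC : ∀ c ∈ C, Even (hammingNorm c)) :
    ∑ c : C, quadSign (c : Fin n → ZMod 2) = 0 ∨
    ((∑ c : C, quadSign (c : Fin n → ZMod 2)) ^ 2 =
        2 ^ (Module.finrank (ZMod 2) C + Module.finrank (ZMod 2) (hull C)) ∧
      ∀ z ∈ hull C, quadSign z = 1) := by
  classical
  have : Fintype (hull C) := Fintype.ofFinite _
  have h := sq_sum_quadSign C hC
  by_cases hd : ∀ z ∈ hull C, quadSign z = 1
  · right
    refine ⟨?_, hd⟩
    rw [h, Finset.sum_congr rfl (fun (z : hull C) _ => hd _ z.2)]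
    simp [card_eq_two_pow, pow_add]
  · left
    push Not at hd
    obtain ⟨d, hdm, hd1⟩ := hd
    have hd2 : quadSign d = -1 := (quadSign_eq d).resolve_left hd1
    have h3 : ∑ z : hull C, quadSign (z : Fin n → ZMod 2) =
        ∑ z : hull C, quadSign ((z + ⟨d, hdm⟩ : hull C) : Fin n → ZMod 2) :=
      (Fintype.sum_equiv (Equiv.addRight (⟨d, hdm⟩ : hull C)) _ _ (fun c => rfl)).symm
    have h4 : ∀ z : hull C, quadSign ((z + ⟨d, hdm⟩ : hull C) : Fin n → ZMod 2) =
        - quadSign (z : Fin n → ZMod 2) := by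
      intro z
      rw [Submodule.coe_add, quadSign_add (hC _ z.2.1) (hC _ hdm.1), hdm.2 _ z.2.1, hd2]
      simp
    simp_rw [h4, Finset.sum_neg_distrib] at h3
    have h5 : ∑ z : hull C, quadSign (z : Fin n → ZMod 2) = 0 := by linarith
    rw [h5, mul_zero] at h
    exact pow_eq_zero_iff (two_ne_zero) |>.1 h

/-- An even binary linear code of dimension `k` whose nonzero words have weight at least `10`. -/
structure IsCode {n : ℕ} (C : Submodule (ZMod 2) (Fin n → ZMod 2)) (k : ℕ) : Prop where
  finrank : Module.finrank (ZMod 2) C = k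
  ten_le : ∀ v ∈ C, v ≠ 0 → 10 ≤ hammingNorm v
  even : ∀ v ∈ C, Even (hammingNorm v)

lemma exists_submodule_finrank_eq {n k : ℕ} (C : Submodule (ZMod 2) (Fin n → ZMod 2))
    (h : k ≤ Module.finrank (ZMod 2) C) :
    ∃ D ≤ C, Module.finrank (ZMod 2) D = k := by
  obtain ⟨f, hf⟩ := exists_linearIndependent_of_le_finrank h
  refine ⟨Submodule.span (ZMod 2) (Set.range fun i => (f i : Fin n → ZMod 2)), ?_, ?_⟩
  · rw [Submodule.span_le]
    rintro _ ⟨i, rfl⟩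
    exact (f i).2
  · have := finrank_span_eq_card (R := ZMod 2)
      (hf.map' C.subtype (LinearMap.ker_eq_bot.2 C.subtype_injective))
    rwa [Fintype.card_fin] at this

lemma norm_extend {m n : ℕ} (f : Fin m ↪ Fin n) (x : Fin m → ZMod 2) :
    hammingNorm (Function.extend f x 0) = hammingNorm x := by
  classical
  rw [hammingNorm, hammingNorm, ← Finset.card_map f]
  congr 1
  ext i
  simp only [Finset.mem_filter, Finset.mem_univ, true_and, Finset.mem_map]
  constructor
  · intro h
    by_cases hi : ∃ a, f a = i
    · obtain ⟨a, rfl⟩ := hi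
      exact ⟨a, by simpa [f.injective.extend_apply] using h, rfl⟩
    · rw [Function.extend_apply' _ _ _ hi] at h
      simp at h
  · rintro ⟨a, ha, rfl⟩
    simpa [f.injective.extend_apply] using ha

/-- The shortened code: words of `C` vanishing outside the range of `f`. -/
noncomputable def shorten {m n : ℕ} (C : Submodule (ZMod 2) (Fin n → ZMod 2)) (f : Fin m ↪ Fin n) :
    Submodule (ZMod 2) (Fin m → ZMod 2) :=
  C.comap (Function.ExtendByZero.linearMap (ZMod 2) f)

lemma mem_shorten {m n : ℕ} {C : Submodule (ZMod 2) (Fin n → ZMod 2)} {f : Fin m ↪ Fin n}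
    {x : Fin m → ZMod 2} : x ∈ shorten C f ↔ Function.extend f x 0 ∈ C := Iff.rfl

lemma extend_comp_of_vanish {m n : ℕ} (f : Fin m ↪ Fin n) {T : Finset (Fin n)}
    (hT : ∀ i, i ∈ T ↔ i ∉ Set.range f) {y : Fin n → ZMod 2} (hy : ∀ i ∈ T, y i = 0) :
    Function.extend f (y ∘ f) 0 = y := by
  funext i
  by_cases hi : ∃ a, f a = i
  · obtain ⟨a, rfl⟩ := hi
    rw [f.injective.extend_apply]; rfl
  · rw [Function.extend_apply' _ _ _ hi, hy i ((hT i).2 hi)]; rfl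

/-- Restriction of the words of `C` to the coordinates in `T`. -/
def restrict {n : ℕ} (C : Submodule (ZMod 2) (Fin n → ZMod 2)) (T : Finset (Fin n)) :
    C →ₗ[ZMod 2] (T → ZMod 2) :=
  (LinearMap.funLeft (ZMod 2) (ZMod 2) (Subtype.val : T → Fin n)).comp C.subtype

lemma finrank_shorten {m n : ℕ} (C : Submodule (ZMod 2) (Fin n → ZMod 2)) (f : Fin m ↪ Fin n)
    {T : Finset (Fin n)} (hT : ∀ i, i ∈ T ↔ i ∉ Set.range f) :
    Module.finrank (ZMod 2) (LinearMap.range (restrict C T)) +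
      Module.finrank (ZMod 2) (shorten C f) = Module.finrank (ZMod 2) C := by
  rw [← LinearMap.finrank_range_add_finrank_ker (restrict C T)]
  congr 1
  have hinj : Function.Injective (Function.ExtendByZero.linearMap (ZMod 2) f :
      (Fin m → ZMod 2) →ₗ[ZMod 2] (Fin n → ZMod 2)) :=
    Function.extend_injective f.injective _
  rw [LinearEquiv.finrank_eq (Submodule.equivMapOfInjective _ hinj (shorten C f)),
    LinearEquiv.finrank_eq (Submodule.equivMapOfInjective C.subtype C.subtype_injective
      (LinearMap.ker (restrict C T)))]
  have : (shorten C f).map (Function.ExtendByZero.linearMap (ZMod 2) f) =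
      (LinearMap.ker (restrict C T)).map C.subtype := by
    ext y
    constructor
    · rintro ⟨x, hx, rfl⟩
      refine ⟨⟨_, hx⟩, ?_, rfl⟩
      rw [SetLike.mem_coe, LinearMap.mem_ker]
      funext i
      exact Function.extend_apply' _ _ _ ((hT i).1 i.2)
    · rintro ⟨y, hy, rfl⟩
      rw [SetLike.mem_coe, LinearMap.mem_ker] at hy
      have := extend_comp_of_vanish f hT (y := y) fun i hi => congrFun hy ⟨i, hi⟩
      exact ⟨(y : Fin n → ZMod 2) ∘ f, by rw [SetLike.mem_coe, mem_shorten, this]; exact y.2, this⟩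
  rw [this]

/-- The parity functional of `S` on words indexed by `T`. -/
def parityOn {n : ℕ} (S T : Finset (Fin n)) : Module.Dual (ZMod 2) (T → ZMod 2) :=
  ∑ i : T, (if (i : Fin n) ∈ S then (1 : ZMod 2) else 0) • LinearMap.proj i

lemma parityOn_apply {n : ℕ} {S T : Finset (Fin n)} (hST : S ⊆ T) (x : Fin n → ZMod 2) :
    parityOn S T (fun i => x i) = ∑ i ∈ S, x i := by
  simp only [parityOn, LinearMap.sum_apply, LinearMap.smul_apply, LinearMap.proj_apply,
    smul_eq_mul, ite_mul, one_mul, zero_mul]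
  rw [Finset.sum_coe_sort T (fun i => if i ∈ S then x i else 0), ← Finset.sum_filter]
  congr 1
  ext i
  simp only [Finset.mem_filter]
  exact ⟨fun h => h.2, fun h => ⟨hST h, h⟩⟩

lemma finrank_ker_parityOn {n : ℕ} {S T : Finset (Fin n)} (hST : S ⊆ T) (hS : S.Nonempty) :
    Module.finrank (ZMod 2) (LinearMap.ker (parityOn S T)) + 1 = T.card := by
  have : parityOn S T ≠ 0 := by
    obtain ⟨a, ha⟩ := hS
    intro h
    have := parityOn_apply hST (Pi.single a 1)
    rw [h, LinearMap.zero_apply, Finset.sum_eq_single a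
      (fun b _ hb => Pi.single_eq_of_ne hb _) (fun h => absurd ha h), Pi.single_eq_same] at this
    exact zero_ne_one this
  rw [Module.Dual.finrank_ker_add_one_of_ne_zero this]
  simp

lemma range_restrict_le {n : ℕ} {C : Submodule (ZMod 2) (Fin n → ZMod 2)} {S T : Finset (Fin n)}
    (hST : S ⊆ T) (hS : IsDual C S) :
    LinearMap.range (restrict C T) ≤ LinearMap.ker (parityOn S T) := by
  rintro _ ⟨x, rfl⟩
  rw [LinearMap.mem_ker]
  exact (parityOn_apply hST (x : Fin n → ZMod 2)).trans (hS x x.2)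

/-- An embedding onto the complement of `T`. -/
lemma exists_embedding_compl {m n : ℕ} (T : Finset (Fin n)) (h : m + T.card = n) :
    ∃ f : Fin m ↪ Fin n, ∀ i, i ∈ T ↔ i ∉ Set.range f := by
  have hc : Tᶜ.card = m := by rw [Finset.card_compl, Fintype.card_fin]; omega
  refine ⟨(Tᶜ.orderEmbOfFin hc).toEmbedding, fun i => ?_⟩
  have := Tᶜ.range_orderEmbOfFin hc
  simp only [RelEmbedding.coe_toEmbedding, this]
  simp

lemma IsCode.mono {n k l : ℕ} {C : Submodule (ZMod 2) (Fin n → ZMod 2)} (hC : IsCode C k)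
    (h : l ≤ k) : ∃ D ≤ C, IsCode D l := by
  obtain ⟨D, hD, hr⟩ := exists_submodule_finrank_eq C (k := l) (by rw [hC.finrank]; exact h)
  exact ⟨D, hD, hr, fun v hv => hC.ten_le v (hD hv), fun v hv => hC.even v (hD hv)⟩

lemma IsCode.shorten {m n k : ℕ} {C : Submodule (ZMod 2) (Fin n → ZMod 2)} (hC : IsCode C k)
    (f : Fin m ↪ Fin n) : IsCode (shorten C f) (Module.finrank (ZMod 2) (shorten C f)) := by
  refine ⟨rfl, fun v hv hv0 => ?_, fun v hv => ?_⟩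
  · rw [← norm_extend f]
    refine hC.ten_le _ (mem_shorten.1 hv) fun h => hv0 ?_
    refine Function.extend_injective f.injective (0 : Fin n → ZMod 2) (h.trans ?_)
    exact (map_zero (Function.ExtendByZero.linearMap (ZMod 2) f)).symm
  · rw [← norm_extend f]
    exact hC.even _ (mem_shorten.1 hv)

/-- Shortening at a coordinate set `T` containing a nonempty dual set. -/
lemma IsCode.exists_shorten {m n k l : ℕ} {C : Submodule (ZMod 2) (Fin n → ZMod 2)}
    (hC : IsCode C k) {S : Finset (Fin n)} (hS : S.Nonempty) (hd : IsDual C S)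
    (t : ℕ) (hSt : S.card ≤ t) (hm : m + t = n) (hk : l + t ≤ k + 1) :
    ∃ D : Submodule (ZMod 2) (Fin m → ZMod 2), IsCode D l := by
  obtain ⟨T, hST, hT⟩ := Finset.exists_superset_card_eq hSt (by rw [Fintype.card_fin]; omega)
  obtain ⟨f, hf⟩ := exists_embedding_compl (m := m) T (by omega)
  have h1 := finrank_shorten C f hf
  have h2 := finrank_ker_parityOn hST hS
  have h3 := Submodule.finrank_mono (range_restrict_le hST hd)
  have h4 := hC.finrank
  obtain ⟨D, -, hD⟩ := (hC.shorten f).mono (l := l) (by omega)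
  exact ⟨D, hD⟩

lemma zmod_two_cases : ∀ a : ZMod 2, a = 0 ∨ a = 1 := by decide

lemma sum_ge_of_forall {n : ℕ} (C : Submodule (ZMod 2) (Fin n → ZMod 2)) [Fintype C]
    (g : (Fin n → ZMod 2) → ℤ) (hg : ∀ c ∈ C, c ≠ 0 → 0 ≤ g c) :
    g 0 ≤ ∑ c : C, g c := by
  classical
  have h := Finset.sum_erase_add (Finset.univ : Finset C) (fun c => g c) (Finset.mem_univ 0)
  have h2 : 0 ≤ ∑ c ∈ Finset.univ.erase (0 : C), g c :=
    Finset.sum_nonneg fun c hc => hg c c.2 fun h0 =>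
      (Finset.mem_erase.1 hc).1 (Subtype.ext h0)
  simp only [Submodule.coe_zero] at h
  linarith

/-- The linear programming bound with a target function `s` of the weight. -/
lemma lp_bound {n : ℕ} (C : Submodule (ZMod 2) (Fin n → ZMod 2)) [Fintype C] (P : ℕ → Prop)
    (hP : ∀ c ∈ C, c ≠ 0 → P (hammingNorm c)) (J : ℕ) (b s : ℕ → ℤ)
    (hb : ∀ j, 1 ≤ j → j ≤ J → 0 ≤ b j ∨ ∀ S : Finset (Fin n), S.card = j → ¬ IsDual C S)
    (hs : ∀ w < n + 1, P w → ∑ j ∈ Finset.range (J + 1), b j * kraw n j w ≤ s w) :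
    Fintype.card C * b 0 - (∑ j ∈ Finset.range (J + 1), b j * kraw n j 0) + s 0 ≤
      ∑ c : C, s (hammingNorm (c : Fin n → ZMod 2)) := by
  have h1 := delsarte C J b hb
  have h2 := sum_ge_of_forall C (fun c => s (hammingNorm c) -
    ∑ j ∈ Finset.range (J + 1), b j * kraw n j (hammingNorm c)) (fun c hc hc0 => by
      have hle : hammingNorm c ≤ n := by simpa using hammingNorm_le_card_fintype (x := c)
      have := hs _ (Nat.lt_succ_of_le hle) (hP c hc hc0)
      linarith)
  simp only [hammingNorm_zero, Finset.sum_sub_distrib] at h2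
  linarith

lemma IsCode.weight {n k : ℕ} {C : Submodule (ZMod 2) (Fin n → ZMod 2)} (hC : IsCode C k) :
    ∀ c ∈ C, c ≠ 0 → (10 ≤ hammingNorm c ∧ hammingNorm c % 2 = 0) :=
  fun c hc h0 => ⟨hC.ten_le c hc h0, Nat.even_iff.1 (hC.even c hc)⟩

lemma IsCode.card {n k : ℕ} {C : Submodule (ZMod 2) (Fin n → ZMod 2)} [Fintype C]
    (hC : IsCode C k) : Fintype.card C = 2 ^ k := by
  rw [card_eq_two_pow, hC.finrank]

lemma not_isCode_nineteen_four (C : Submodule (ZMod 2) (Fin 19 → ZMod 2)) : ¬ IsCode C 4 := by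
  intro hC
  have : Fintype C := Fintype.ofFinite _
  have h1 := lp_bound C (fun w => 10 ≤ w ∧ w % 2 = 0) hC.weight 0 (fun _ => -1)
      (fun w => (-1) ^ (w / 2))
    (by intro j h1 h2; omega) (by decide +kernel)
  have h2 := lp_bound C (fun w => 10 ≤ w ∧ w % 2 = 0) hC.weight 1 (fun j => [3, 1].getD j 0)
      (fun w => 2 * -(-1) ^ (w / 2))
    (by intro j h1 h2; interval_cases j; simp) (by decide +kernel)
  have e1 : ∑ j ∈ Finset.range (0 + 1), (fun _ => -1 : ℕ → ℤ) j * kraw 19 j 0 = -1 := by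
    decide +kernel
  have e2 : ∑ j ∈ Finset.range (1 + 1), ([3, 1] : List ℤ).getD j 0 * kraw 19 j 0 = 22 := by
    decide +kernel
  rw [e1, hC.card] at h1
  rw [e2, hC.card] at h2
  rw [← Finset.mul_sum, Finset.sum_neg_distrib] at h2
  have h3 := sq_sum_quadSign_eq C hC.even
  simp only [quadSign] at h3
  generalize ∑ c : C, (-1 : ℤ) ^ (hammingNorm (c : Fin 19 → ZMod 2) / 2) = S at h1 h2 h3
  norm_num at h1 h2
  rcases h3 with h3 | ⟨h3, -⟩
  · omega
  · generalize Module.finrank (ZMod 2) C + Module.finrank (ZMod 2) (hull C) = m at h3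
    have h4 : m < 8 := by
      rw [← Nat.pow_lt_pow_iff_right (a := 2) (by norm_num)]
      zify
      rw [← h3]
      nlinarith
    interval_cases m <;> norm_num at h3 <;> first | omega | nlinarith

lemma not_isCode_twentyone_six (C : Submodule (ZMod 2) (Fin 21 → ZMod 2)) : ¬ IsCode C 6 := by
  intro hC
  have : Fintype C := Fintype.ofFinite _
  have h1 := lp_bound C (fun w => 10 ≤ w ∧ w % 2 = 0) hC.weight 3 (fun j => [40, 24, 7, 1].getD j 0)
    (fun w => 16 * (-1) ^ (w / 2))
    (by intro j h1 h2; interval_cases j <;> simp) (by decide +kernel)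
  have h2 := lp_bound C (fun w => 10 ≤ w ∧ w % 2 = 0) hC.weight 3
      (fun j => [140, 60, 11, 1].getD j 0)
    (fun w => 80 * -(-1) ^ (w / 2))
    (by intro j h1 h2; interval_cases j <;> simp) (by decide +kernel)
  have e1 : ∑ j ∈ Finset.range (3 + 1), ([40, 24, 7, 1] : List ℤ).getD j 0 * kraw 21 j 0 =
      3344 := by
    decide +kernel
  have e2 : ∑ j ∈ Finset.range (3 + 1), ([140, 60, 11, 1] : List ℤ).getD j 0 * kraw 21 j 0 =
      5040 := by
    decide +kernel
  rw [e1, hC.card] at h1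
  rw [e2, hC.card] at h2
  rw [← Finset.mul_sum] at h1
  rw [← Finset.mul_sum, Finset.sum_neg_distrib] at h2
  have h3 := sq_sum_quadSign_eq C hC.even
  simp only [quadSign] at h3
  generalize ∑ c : C, (-1 : ℤ) ^ (hammingNorm (c : Fin 21 → ZMod 2) / 2) = S at h1 h2 h3
  norm_num at h1 h2
  obtain rfl : S = -48 := by omega
  rcases h3 with h3 | ⟨h3, -⟩
  · omega
  · generalize Module.finrank (ZMod 2) C + Module.finrank (ZMod 2) (hull C) = m at h3
    have h4 : m < 12 := by
      rw [← Nat.pow_lt_pow_iff_right (a := 2) (by norm_num)]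
      zify
      rw [← h3]
      norm_num
    interval_cases m <;> norm_num at h3

lemma IsCode.exists_dual_card_le_four {C : Submodule (ZMod 2) (Fin 25 → ZMod 2)}
    (hC : IsCode C 8) : ∃ S : Finset (Fin 25), 1 ≤ S.card ∧ S.card ≤ 4 ∧ IsDual C S := by
  by_contra! h
  have : Fintype C := Fintype.ofFinite _
  have h1 := lp_bound C (fun w => 10 ≤ w ∧ w % 2 = 0) hC.weight 4
      (fun j => [-45, -9, -9, -1, -1].getD j 0) (fun _ => 0)
    (fun j h1 h2 => Or.inr fun S hS => h S (by omega) (by omega)) (by decide +kernel)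
  have e1 : ∑ j ∈ Finset.range (4 + 1), ([-45, -9, -9, -1, -1] : List ℤ).getD j 0 * kraw 25 j 0 =
      -17920 := by decide +kernel
  rw [e1, hC.card] at h1
  simp at h1

lemma not_doubly_even (D : Submodule (ZMod 2) (Fin 31 → ZMod 2))
    (hr : Module.finrank (ZMod 2) D = 12)
    (h : ∀ c ∈ D, c ≠ 0 → (12 ≤ hammingNorm c ∧ hammingNorm c % 4 = 0)) : False := by
  have : Fintype D := Fintype.ofFinite _
  have h1 := lp_bound D (fun w => 12 ≤ w ∧ w % 4 = 0) h 4
      (fun j => [70, 40, 16, 7, 1].getD j 0) (fun _ => 0)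
    (by intro j h1 h2; interval_cases j <;> simp) (by decide +kernel)
  have e1 : ∑ j ∈ Finset.range (4 + 1), ([70, 40, 16, 7, 1] : List ℤ).getD j 0 * kraw 31 j 0 =
      71680 := by decide +kernel
  rw [e1, card_eq_two_pow, hr] at h1
  simp at h1

lemma quadSign_eq_one {n : ℕ} {x : Fin n → ZMod 2} (hx : Even (hammingNorm x))
    (h : quadSign x = 1) : hammingNorm x % 4 = 0 := by
  rw [quadSign, neg_one_pow_eq_one_iff_even (by norm_num)] at h
  obtain ⟨a, ha⟩ := hx
  obtain ⟨b, hb⟩ := h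
  omega

lemma sum_quadSign_eq {C : Submodule (ZMod 2) (Fin 31 → ZMod 2)} [Fintype C] (hC : IsCode C 13)
    (h : ∀ S : Finset (Fin 31), 1 ≤ S.card → S.card ≤ 6 → ¬ IsDual C S) :
    ∑ c : C, quadSign (c : Fin 31 → ZMod 2) = 4096 ∧ Module.finrank (ZMod 2) (hull C) = 11 ∧
      ∀ z ∈ hull C, quadSign z = 1 := by
  have h1 := lp_bound C (fun w => 10 ≤ w ∧ w % 2 = 0) hC.weight 6
      (fun j => [-128, -37, -37, -8, -8, -1, -1].getD j 0)
    (fun w => 64 * (-1) ^ (w / 2))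
    (fun j h1 h2 => Or.inr fun S hS => h S (by omega) (by omega)) (by decide +kernel)
  have h2 := lp_bound C (fun w => 10 ≤ w ∧ w % 2 = 0) hC.weight 6
    (fun j => [-3290, 7000, 2443, 1015, 457, 185, 30].getD j 0)
    (fun w => 16800 * -(-1) ^ (w / 2))
    (fun j h1 h2 => Or.inr fun S hS => h S (by omega) (by omega)) (by decide +kernel)
  have e1 : ∑ j ∈ Finset.range (6 + 1), ([-128, -37, -37, -8, -8, -1, -1] : List ℤ).getD j 0 *
      kraw 31 j 0 = -1212352 := by decide +kernel
  have e2 : ∑ j ∈ Finset.range (6 + 1), ([-3290, 7000, 2443, 1015, 457, 185, 30] : List ℤ).getD j 0 *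
      kraw 31 j 0 = 73813600 := by decide +kernel
  rw [e1, hC.card] at h1
  rw [e2, hC.card] at h2
  rw [← Finset.mul_sum] at h1
  rw [← Finset.mul_sum, Finset.sum_neg_distrib] at h2
  have h3 := sq_sum_quadSign_eq C hC.even
  rw [hC.finrank] at h3
  have e : ∑ c : C, quadSign (c : Fin 31 → ZMod 2) =
    ∑ c : C, (-1 : ℤ) ^ (hammingNorm (c : Fin 31 → ZMod 2) / 2) := rfl
  rw [← e] at h1 h2
  generalize ∑ c : C, quadSign (c : Fin 31 → ZMod 2) = S at h1 h2 h3
  norm_num at h1 h2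
  rcases h3 with h3 | ⟨h3, h4⟩
  · omega
  · generalize Module.finrank (ZMod 2) (hull C) = r at h3
    have h5 : 13 + r < 26 := by
      rw [← Nat.pow_lt_pow_iff_right (a := 2) (by norm_num)]
      zify
      rw [← h3]
      nlinarith
    have h6 : 22 < 13 + r := by
      rw [← Nat.pow_lt_pow_iff_right (a := 2) (by norm_num)]
      zify
      rw [← h3]
      nlinarith
    obtain rfl | rfl | rfl : r = 10 ∨ r = 11 ∨ r = 12 := by omega
    · norm_num at h3
      rcases le_or_gt S 2896 with h | h <;> nlinarith
    · norm_num at h3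
      refine ⟨?_, rfl, h4⟩
      nlinarith
    · norm_num at h3
      rcases le_or_gt S 5792 with h | h <;> nlinarith

lemma IsCode.exists_dual_card_le_six {C : Submodule (ZMod 2) (Fin 31 → ZMod 2)}
    (hC : IsCode C 13) : ∃ S : Finset (Fin 31), 1 ≤ S.card ∧ S.card ≤ 6 ∧ IsDual C S := by
  classical
  by_contra! h
  have : Fintype C := Fintype.ofFinite _
  have : Fintype (hull C) := Fintype.ofFinite _
  obtain ⟨hS, hr, hh⟩ := sum_quadSign_eq hC h
  obtain ⟨x, hxC, hx1, hx⟩ : ∃ x ∈ C, quadSign x = 1 ∧ x ∉ hull C := by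
    by_contra! hcon
    have h1 : ∑ c : C, quadSign (c : Fin 31 → ZMod 2) ≤
        ∑ c : C, if (c : Fin 31 → ZMod 2) ∈ hull C then 1 else 0 := by
      refine Finset.sum_le_sum fun c _ => ?_
      rcases quadSign_eq (c : Fin 31 → ZMod 2) with h | h
      · rw [h, if_pos (hcon c c.2 h)]
      · rw [h]; split_ifs <;> norm_num
    rw [hS, ← Finset.sum_filter, Finset.sum_const, nsmul_eq_mul, mul_one] at h1
    have h2 : (Finset.univ.filter fun c : C => (c : Fin 31 → ZMod 2) ∈ hull C).card ≤
        (Finset.univ : Finset (hull C)).card := by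
      refine Finset.card_le_card_of_injOn (fun c => if hc : (c : Fin 31 → ZMod 2) ∈ hull C then
        ⟨c, hc⟩ else 0) (fun _ _ => Finset.mem_coe.2 (Finset.mem_univ _)) ?_
      intro a ha b hb hab
      have ha' := (Finset.mem_filter.1 (Finset.mem_coe.1 ha)).2
      have hb' := (Finset.mem_filter.1 (Finset.mem_coe.1 hb)).2
      simp only [dif_pos ha', dif_pos hb'] at hab
      exact Subtype.ext (congrArg (fun t : hull C => (t : Fin 31 → ZMod 2)) hab)
    rw [Finset.card_univ, card_eq_two_pow, hr] at h2
    norm_num at h2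
    omega
  have hlt : hull C < hull C ⊔ Submodule.span (ZMod 2) {x} := by
    refine lt_of_le_of_ne le_sup_left fun he => hx ?_
    rw [he]
    exact Submodule.mem_sup_right (Submodule.mem_span_singleton_self x)
  have hlt' := Submodule.finrank_lt_finrank_of_lt hlt
  obtain ⟨D, hD, hDr⟩ := exists_submodule_finrank_eq
    (hull C ⊔ Submodule.span (ZMod 2) {x}) (k := 12) (by omega)
  refine not_doubly_even D hDr fun c hc hc0 => ?_
  obtain ⟨z, hz, y, hy, rfl⟩ := Submodule.mem_sup.1 (hD hc)
  obtain ⟨a, rfl⟩ := Submodule.mem_span_singleton.1 hy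
  have hmem : z + a • x ∈ C := C.add_mem hz.1 (C.smul_mem a hxC)
  have h4 : hammingNorm (z + a • x) % 4 = 0 := by
    refine quadSign_eq_one (hC.even _ hmem) ?_
    obtain rfl | rfl : a = 0 ∨ a = 1 := zmod_two_cases a
    · rw [zero_smul, add_zero, hh z hz]
    · have : ∑ i, z i * x i = 0 := by
        simp only [mul_comm (z _)]
        exact hz.2 x hxC
      rw [one_smul, quadSign_add (hC.even _ hz.1) (hC.even _ hxC), hh z hz, hx1, this]
      rfl
  have := hC.ten_le _ hmem hc0
  omega

lemma norm_sum_two {n : ℕ} (x y : Fin n → ZMod 2) :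
    hammingNorm x + hammingNorm y + hammingNorm (x + y) =
      2 * (Finset.univ.filter fun i => ¬ (x i = 0 ∧ y i = 0)).card := by
  simp only [norm_eq_sum, Finset.card_filter, Finset.mul_sum, ← Finset.sum_add_distrib]
  refine Finset.sum_congr rfl fun i _ => ?_
  have : ∀ a b : ZMod 2, (if a ≠ 0 then 1 else 0) + (if b ≠ 0 then 1 else 0) +
      (if a + b ≠ 0 then 1 else 0) = 2 * (if ¬ (a = 0 ∧ b = 0) then 1 else 0) := by decide
  exact this _ _

lemma norm_sum_three {n : ℕ} (x y z : Fin n → ZMod 2) :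
    hammingNorm x + hammingNorm y + hammingNorm (x + y) + hammingNorm z + hammingNorm (z + x) +
      hammingNorm (z + y) + hammingNorm (z + (x + y)) =
      4 * (Finset.univ.filter fun i => ¬ (x i = 0 ∧ y i = 0 ∧ z i = 0)).card := by
  simp only [norm_eq_sum, Finset.card_filter, Finset.mul_sum, ← Finset.sum_add_distrib]
  refine Finset.sum_congr rfl fun i _ => ?_
  have : ∀ a b c : ZMod 2, (if a ≠ 0 then 1 else 0) + (if b ≠ 0 then 1 else 0) +
      (if a + b ≠ 0 then 1 else 0) + (if c ≠ 0 then 1 else 0) + (if c + a ≠ 0 then 1 else 0) +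
      (if c + b ≠ 0 then 1 else 0) + (if c + (a + b) ≠ 0 then 1 else 0) =
      4 * (if ¬ (a = 0 ∧ b = 0 ∧ c = 0) then 1 else 0) := by decide
  exact this _ _ _

lemma exists_finrank_ker {n k m : ℕ} (C : Submodule (ZMod 2) (Fin n → ZMod 2))
    (φ : (Fin n → ZMod 2) →ₗ[ZMod 2] (Fin m → ZMod 2))
    (h : k + m ≤ Module.finrank (ZMod 2) C) :
    ∃ D ≤ C, Module.finrank (ZMod 2) D = k ∧ ∀ x ∈ D, φ x = 0 := by
  have h1 := Submodule.finrank_sup_add_finrank_inf_eq C (LinearMap.ker φ)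
  have h2 := Submodule.finrank_le (C ⊔ LinearMap.ker φ)
  have h3 := LinearMap.finrank_range_add_finrank_ker φ
  have h4 := Submodule.finrank_le (LinearMap.range φ)
  rw [Module.finrank_fin_fun] at h4
  obtain ⟨D, hD, hDr⟩ := exists_submodule_finrank_eq (C ⊓ LinearMap.ker φ) (k := k) (by omega)
  exact ⟨D, fun x hx => (hD hx).1, hDr, fun x hx => (hD hx).2⟩

lemma not_isDual_of_card_le_two {K : Submodule (ZMod 2) (Fin 21 → ZMod 2)} (hK : IsCode K 5)
    (S : Finset (Fin 21)) (h1 : 1 ≤ S.card) (h2 : S.card ≤ 2) : ¬ IsDual K S := by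
  intro hS
  obtain ⟨D, hD⟩ := hK.exists_shorten (Finset.card_pos.1 h1) hS 2 h2 (m := 19) (l := 4)
    (by norm_num) (by norm_num)
  exact not_isCode_nineteen_four D hD

lemma eq_of_forall_mem_eq {K : Submodule (ZMod 2) (Fin 21 → ZMod 2)} (hK : IsCode K 5)
    {i j : Fin 21} (h : ∀ c ∈ K, c i = c j) : i = j := by
  by_contra hij
  refine not_isDual_of_card_le_two hK {i, j} ?_ ?_ fun c hc => ?_
  · rw [Finset.card_pair hij]; norm_num
  · rw [Finset.card_pair hij]
  · rw [Finset.sum_pair hij, h c hc, CharTwo.add_self_eq_zero]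

lemma exists_perm {K : Submodule (ZMod 2) (Fin 21 → ZMod 2)} (hK : IsCode K 5)
    (g : Fin 5 → Fin 21 → ZMod 2) (hg : ∀ j, g j ∈ K) (hli : LinearIndependent (ZMod 2) g)
    (t : Fin 5 → Fin 21 → ZMod 2) (ht : ∀ i, ∃ p, ∀ j, g j i = t j p) :
    ∃ e : Equiv.Perm (Fin 21), ∀ j, g j = t j ∘ e := by
  have hspan : Submodule.span (ZMod 2) (Set.range g) = K := by
    refine Submodule.eq_of_le_of_finrank_eq ?_ ?_
    · rw [Submodule.span_le]
      rintro _ ⟨j, rfl⟩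
      exact hg j
    · rw [finrank_span_eq_card hli, hK.finrank, Fintype.card_fin]
  choose e he using ht
  have hinj : Function.Injective e := by
    intro a b hab
    refine eq_of_forall_mem_eq hK fun c hc => ?_
    rw [← hspan] at hc
    induction hc using Submodule.span_induction with
    | mem x hx =>
      obtain ⟨j, rfl⟩ := hx
      rw [he, he, hab]
    | zero => rfl
    | add x y _ _ hx hy => simp only [Pi.add_apply, hx, hy]
    | smul r x _ hx => simp only [Pi.smul_apply, hx]
  exact ⟨Equiv.ofBijective e (Finite.injective_iff_bijective.1 hinj),
      fun j => funext fun i => he i j⟩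

lemma weight_cases {K : Submodule (ZMod 2) (Fin 21 → ZMod 2)} (hK : IsCode K 5) :
    (∃ w ∈ K, hammingNorm w = 16) ∨
    (∀ c ∈ K, c ≠ 0 → hammingNorm c = 10 ∨ hammingNorm c = 12 ∨ hammingNorm c = 14) ∧
      ∃ u ∈ K, ∃ v ∈ K, ∃ t ∈ K, hammingNorm u = 14 ∧ hammingNorm v = 14 ∧ hammingNorm t = 14 ∧
        u ≠ v ∧ u ≠ t ∧ v ≠ t := by
  classical
  have : Fintype K := Fintype.ofFinite _
  let F : K → ℤ := fun c => (12 - hammingNorm (c : Fin 21 → ZMod 2)) *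
    (10 - hammingNorm (c : Fin 21 → ZMod 2))
  have hle : ∀ c : K, hammingNorm (c : Fin 21 → ZMod 2) ≤ 21 := fun c => by
    simpa using hammingNorm_le_card_fintype (x := (c : Fin 21 → ZMod 2))
  have hsum : ∑ c : K, F c = 144 := by
    have h := delsarte_eq K 2 (fun j => [9, 1, 1].getD j 0) (not_isDual_of_card_le_two hK)
    rw [hK.card] at h
    have h2 : ∀ w < 22, ∑ j ∈ Finset.range (2 + 1), ([9, 1, 1] : List ℤ).getD j 0 * kraw 21 j w =
        2 * ((12 - w) * (10 - w)) := by decide +kernel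
    have h3 : ∑ c : K, ∑ j ∈ Finset.range (2 + 1), ([9, 1, 1] : List ℤ).getD j 0 *
        kraw 21 j (hammingNorm (c : Fin 21 → ZMod 2)) = 2 * ∑ c : K, F c := by
      rw [Finset.mul_sum]
      exact Finset.sum_congr rfl fun c _ => h2 _ (Nat.lt_succ_of_le (hle c))
    rw [h3] at h
    norm_num at h
    omega
  have hval : ∀ c : K, c ≠ 0 → (hammingNorm (c : Fin 21 → ZMod 2) = 10 ∧ F c = 0) ∨
      (hammingNorm (c : Fin 21 → ZMod 2) = 12 ∧ F c = 0) ∨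
      (hammingNorm (c : Fin 21 → ZMod 2) = 14 ∧ F c = 8) ∨
      (hammingNorm (c : Fin 21 → ZMod 2) = 16) ∨ 48 ≤ F c := by
    intro c hc
    have h1 := hK.weight c c.2 fun h => hc (Subtype.ext h)
    have h2 := hle c
    simp only [F]
    generalize hammingNorm (c : Fin 21 → ZMod 2) = w at h1 h2
    obtain ⟨h3, h4⟩ := h1
    interval_cases w <;> simp at h4 ⊢
  have hF0 : F 0 = 120 := by simp [F]
  by_cases h16 : ∃ w ∈ K, hammingNorm w = 16
  · exact Or.inl h16
  · right
    push Not at h16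
    have hpos : ∀ c : K, 0 ≤ F c := by
      intro c
      by_cases hc : c = 0
      · rw [hc, hF0]; norm_num
      · have := h16 c c.2
        have := hval c hc
        omega
    have h48 : ∀ c : K, c ≠ 0 → F c < 48 := by
      intro c hc
      have h1 := Finset.sum_le_sum_of_subset_of_nonneg (Finset.subset_univ ({0, c} : Finset K))
        (fun i _ _ => hpos i)
      rw [Finset.sum_pair hc.symm, hsum, hF0] at h1
      omega
    have hF : ∀ c : K, F c = (if c = 0 then 120 else 0) +
        (if hammingNorm (c : Fin 21 → ZMod 2) = 14 then 8 else 0) := by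
      intro c
      by_cases hc : c = 0
      · subst hc; simp [hF0]
      · have := h16 c c.2
        have := hval c hc
        have := h48 c hc
        rw [if_neg hc]
        split_ifs <;> omega
    rw [Finset.sum_congr rfl fun c _ => hF c, Finset.sum_add_distrib, Finset.sum_ite_eq',
      if_pos (Finset.mem_univ _), ← Finset.sum_filter, Finset.sum_const, nsmul_eq_mul] at hsum
    have hcard : 2 < (Finset.univ.filter
      fun c : K => hammingNorm (c : Fin 21 → ZMod 2) = 14).card := by omega
    obtain ⟨u, hu, v, hv, t, ht, huv, hut, hvt⟩ := Finset.two_lt_card.1 hcard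
    rw [Finset.mem_filter] at hu hv ht
    refine ⟨fun c hc h0 => ?_, u, u.2, v, v.2, t, t.2, hu.2, hv.2, ht.2,
      fun h => huv (Subtype.ext h), fun h => hut (Subtype.ext h), fun h => hvt (Subtype.ext h)⟩
    have h0' : (⟨c, hc⟩ : K) ≠ 0 := fun h => h0 (congrArg Subtype.val h)
    have := h16 c hc
    have := hval ⟨c, hc⟩ h0'
    have := h48 ⟨c, hc⟩ h0'
    simp only at *
    omega

/-- The `0`-`1` word given by the binary digits of `N`. -/
def word (n N : ℕ) : Fin n → ZMod 2 := fun i => if N.testBit i then 1 else 0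

/-- The matrix whose columns are the binary expansions of the entries of `l`. -/
def columns (l : List ℕ) (j : Fin 5) (p : Fin 21) : ZMod 2 := word 5 (l.getD p 0) j

/-- The columns of a generator matrix of the `[21, 5, 10]` code with a word of weight `16`. -/
def columnsOne : List ℕ :=
  [17, 18, 19, 20, 21, 22, 23, 24, 25, 26, 27, 28, 29, 30, 31, 15, 1, 2, 4, 8, 16]

/-- The columns of a generator matrix of the `[21, 5, 10]` code without words of weight `16`. -/
def columnsTwo : List ℕ :=
  [18, 26, 11, 19, 27, 20, 28, 13, 21, 29, 14, 22, 30, 15, 23, 31, 9, 17, 25, 10, 12]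

lemma exists_perm_columnsOne {K : Submodule (ZMod 2) (Fin 21 → ZMod 2)} (hK : IsCode K 5)
    {w : Fin 21 → ZMod 2} (hw : w ∈ K) (h16 : hammingNorm w = 16) :
    ∃ e : Equiv.Perm (Fin 21), ∀ j, columns columnsOne j ∘ e ∈ K := by
  classical
  have hw0 : w ≠ 0 := by rintro rfl; simp at h16
  obtain ⟨H, hH⟩ : ∃ H : Finset (Fin 21), H = Finset.univ.filter fun i => w i = 0 := ⟨_, rfl⟩
  have hmem : ∀ i, i ∈ H ↔ w i = 0 := by simp [hH]
  have hcard : H.card = 5 := by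
    have h := Finset.card_filter_add_card_filter_not (s := (Finset.univ : Finset (Fin 21)))
      (fun i => w i = 0)
    rw [hammingNorm] at h16
    rw [← hH] at h
    simp only [Finset.card_univ, Fintype.card_fin] at h
    simp only [ne_eq] at h16
    omega
  have htwo : ∀ x ∈ K, x ≠ 0 → x ≠ w → 2 ≤ (H.filter fun i => x i ≠ 0).card := by
    intro x hx hx0 hxw
    have h1 := norm_add_add x w
    have h2 : hammingNorm x = hammingNorm (x * w) + (H.filter fun i => x i ≠ 0).card := by
      rw [hH, Finset.filter_filter, Finset.card_filter, norm_eq_sum, norm_eq_sum,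
        ← Finset.sum_add_distrib]
      refine Finset.sum_congr rfl fun i _ => ?_
      have : ∀ a b : ZMod 2, (if a ≠ 0 then 1 else 0) = (if a * b ≠ 0 then 1 else 0) +
          if b = 0 ∧ a ≠ 0 then 1 else 0 := by decide
      exact this _ _
    have h3 := hK.ten_le x hx hx0
    have h4 := hK.ten_le (x + w) (K.add_mem hx hw) fun h => hxw (CharTwo.add_eq_zero.1 h)
    omega
  have hker : Module.finrank (ZMod 2) (LinearMap.ker (restrict K H)) ≤ 1 := by
    have hle : LinearMap.ker (restrict K H) ≤ Submodule.span (ZMod 2) {⟨w, hw⟩} := by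
      intro x hx
      rw [LinearMap.mem_ker] at hx
      have : (H.filter fun i => (x : Fin 21 → ZMod 2) i ≠ 0).card = 0 := by
        rw [Finset.card_eq_zero, Finset.filter_eq_empty_iff]
        intro i hi h
        exact h (congrFun hx ⟨i, hi⟩)
      by_cases h0 : x = 0
      · rw [h0]; exact Submodule.zero_mem _
      by_cases h1 : (x : Fin 21 → ZMod 2) = w
      · rw [show x = ⟨w, hw⟩ from Subtype.ext h1]
        exact Submodule.mem_span_singleton_self _
      · have := htwo x x.2 (fun h => h0 (Subtype.ext h)) h1
        omega
    refine (Submodule.finrank_mono hle).trans ?_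
    exact (finrank_span_le_card _).trans (by simp)
  have hrank := LinearMap.finrank_range_add_finrank_ker (restrict K H)
  rw [hK.finrank] at hrank
  have hsingle : ∀ i : H, Pi.single i 1 ∉ LinearMap.range (restrict K H) := by
    rintro i ⟨x, hx⟩
    have hxi : ∀ j : H, (x : Fin 21 → ZMod 2) j = (Pi.single i 1 : H → ZMod 2) j :=
      fun j => congrFun hx j
    have h1 : (x : Fin 21 → ZMod 2) i = 1 := by rw [hxi, Pi.single_eq_same]
    have h2 := htwo x x.2 (fun h => by rw [h] at h1; exact zero_ne_one h1)
      (fun h => by rw [h, (hmem i).1 i.2] at h1; exact zero_ne_one h1)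
    have h3 : (H.filter fun i => (x : Fin 21 → ZMod 2) i ≠ 0) ⊆ {(i : Fin 21)} := by
      intro j hj
      rw [Finset.mem_filter] at hj
      rw [Finset.mem_singleton]
      by_contra hji
      refine hj.2 ((hxi ⟨j, hj.1⟩).trans (Pi.single_eq_of_ne (fun h => hji ?_) _))
      exact congrArg Subtype.val h
    have := Finset.card_le_card h3
    rw [Finset.card_singleton] at this
    omega
  have hpair : ∀ i j : H, Pi.single i 1 + Pi.single j 1 ∈ LinearMap.range (restrict K H) := by
    intro i j
    have hlt : LinearMap.range (restrict K H) <
        LinearMap.range (restrict K H) ⊔ Submodule.span (ZMod 2) {Pi.single i 1} := by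
      refine lt_of_le_of_ne le_sup_left fun he => hsingle i ?_
      rw [he]
      exact Submodule.mem_sup_right (Submodule.mem_span_singleton_self _)
    have h1 := Submodule.finrank_lt_finrank_of_lt hlt
    have htop : LinearMap.range (restrict K H) ⊔ Submodule.span (ZMod 2) {Pi.single i 1} = ⊤ := by
      apply Submodule.eq_top_of_finrank_eq
      have h2 := Submodule.finrank_le
        (LinearMap.range (restrict K H) ⊔ Submodule.span (ZMod 2) {Pi.single i 1})
      rw [Module.finrank_fintype_fun_eq_card, Fintype.card_coe] at h2 ⊢
      omega
    have h3 : Pi.single j 1 ∈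
        LinearMap.range (restrict K H) ⊔ Submodule.span (ZMod 2) {Pi.single i 1} := by
      rw [htop]; trivial
    obtain ⟨r, hr, y, hy, hry⟩ := Submodule.mem_sup.1 h3
    obtain ⟨a, rfl⟩ := Submodule.mem_span_singleton.1 hy
    obtain rfl | rfl := zmod_two_cases a
    · rw [zero_smul, add_zero] at hry
      exact absurd (hry ▸ hr) (hsingle j)
    · rw [one_smul] at hry
      rw [← hry, add_comm r, ← add_assoc, ZModModule.add_self, zero_add]
      exact hr
  let f := (Finset.equivFinOfCardEq hcard).symm
  choose k hk using fun j : Fin 5 => hpair (f j) (f 4)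
  have hkf : ∀ j l, (k j : Fin 21 → ZMod 2) (f l) =
      (if l = j then 1 else 0) + if l = 4 then 1 else 0 := by
    intro j l
    have := congrFun (hk j) (f l)
    simp only [Pi.add_apply, Pi.single_apply, EmbeddingLike.apply_eq_iff_eq] at this
    exact this
  have hwf : ∀ l, w (f l) = 0 := fun l => (hmem _).1 (f l).2
  let g : Fin 5 → Fin 21 → ZMod 2 := ![k 0, k 1, k 2, k 3, w]
  have hg : ∀ j, g j ∈ K := by
    intro j
    fin_cases j
    exacts [(k 0).2, (k 1).2, (k 2).2, (k 3).2, hw]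
  have hli : LinearIndependent (ZMod 2) g := by
    rw [Fintype.linearIndependent_iff]
    intro a ha
    have hl : ∀ l, a 0 * (k 0 : Fin 21 → ZMod 2) l + a 1 * (k 1 : Fin 21 → ZMod 2) l +
        a 2 * (k 2 : Fin 21 → ZMod 2) l + a 3 * (k 3 : Fin 21 → ZMod 2) l + a 4 * w l = 0 := by
      intro l
      have := congrFun ha l
      simpa [Fin.sum_univ_five, g] using this
    have h0 := hl (f 0)
    have h1 := hl (f 1)
    have h2 := hl (f 2)
    have h3 := hl (f 3)
    simp [hkf, hwf] at h0 h1 h2 h3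
    obtain ⟨i, hi⟩ := Function.ne_iff.1 hw0
    have h4 := hl i
    simp [h0, h1, h2, h3] at h4
    intro j
    fin_cases j
    exacts [h0, h1, h2, h3, h4.resolve_right hi]
  obtain ⟨e, he⟩ := exists_perm hK g hg hli (columns columnsOne) fun i => by
    by_cases hi : w i = 0
    · obtain ⟨l, hl⟩ := f.surjective ⟨i, (hmem i).2 hi⟩
      have hki : ∀ j, (k j : Fin 21 → ZMod 2) i =
          (if l = j then 1 else 0) + if l = 4 then 1 else 0 := by
        intro j
        rw [← hkf, hl]
      have key : ∀ l : Fin 5, ∃ p, ∀ j, (![(if l = 0 then 1 else 0) + (if l = 4 then 1 else 0),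
          (if l = 1 then 1 else 0) + (if l = 4 then 1 else 0),
          (if l = 2 then 1 else 0) + (if l = 4 then 1 else 0),
          (if l = 3 then 1 else 0) + (if l = 4 then 1 else 0), 0] : Fin 5 → ZMod 2) j =
          columns columnsOne j p := by decide +kernel
      obtain ⟨p, hp⟩ := key l
      refine ⟨p, fun j => ?_⟩
      rw [← hp]
      fin_cases j
      exacts [hki 0, hki 1, hki 2, hki 3, hi]
    · have key : ∀ a b c d : ZMod 2, ∃ p, ∀ j, ![a, b, c, d, 1] j = columns columnsOne j p := by
        decide +kernel
      obtain ⟨p, hp⟩ := key ((k 0 : Fin 21 → ZMod 2) i) ((k 1 : Fin 21 → ZMod 2) i)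
        ((k 2 : Fin 21 → ZMod 2) i) ((k 3 : Fin 21 → ZMod 2) i)
      refine ⟨p, fun j => ?_⟩
      rw [← hp]
      fin_cases j
      exacts [rfl, rfl, rfl, rfl, (zmod_two_cases _).resolve_left hi]
  exact ⟨e, fun j => he j ▸ hg j⟩

lemma norm_add_ne_ten {K : Submodule (ZMod 2) (Fin 21 → ZMod 2)} (hK : IsCode K 5)
    {u v : Fin 21 → ZMod 2} (hu : u ∈ K) (hv : v ∈ K) (hu14 : hammingNorm u = 14)
    (hv14 : hammingNorm v = 14) : hammingNorm (u + v) ≠ 10 := by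
  intro h10
  have h2 := norm_sum_two u v
  obtain ⟨Z, hZ⟩ : ∃ Z : Finset (Fin 21), Z = Finset.univ.filter fun i => u i = 0 ∧ v i = 0 :=
    ⟨_, rfl⟩
  have hcard : Z.card = 2 := by
    have h := Finset.card_filter_add_card_filter_not (s := (Finset.univ : Finset (Fin 21)))
      (fun i => u i = 0 ∧ v i = 0)
    rw [← hZ] at h
    simp only [Finset.card_univ, Fintype.card_fin] at h
    omega
  let f := (Finset.equivFinOfCardEq hcard).symm
  obtain ⟨D, hD, hDr, hD0⟩ := exists_finrank_ker K
    (LinearMap.funLeft (ZMod 2) (ZMod 2) fun j => (f j : Fin 21)) (k := 3) (by rw [hK.finrank])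
  obtain ⟨x, hx, hxn⟩ : ∃ x ∈ D, x ∉ Submodule.span (ZMod 2) {u, v} := by
    by_contra! hcon
    have h1 := Submodule.finrank_mono (show D ≤ Submodule.span (ZMod 2) {u, v} from hcon)
    have h3 := (finrank_span_le_card (R := ZMod 2) ({u, v} : Set (Fin 21 → ZMod 2)))
    have h4 : ({u, v} : Set (Fin 21 → ZMod 2)).toFinset.card ≤ 2 := by
      simpa using Finset.card_le_two (a := u) (b := v)
    omega
  have hxZ : ∀ i, u i = 0 ∧ v i = 0 → x i = 0 := by
    intro i hi
    obtain ⟨l, hl⟩ := f.surjective ⟨i, by rw [hZ]; simpa using hi⟩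
    have := congrFun (hD0 x hx) l
    rw [LinearMap.funLeft_apply, hl] at this
    exact this
  have h3 := norm_sum_three u v x
  have h4 : (Finset.univ.filter fun i => ¬ (u i = 0 ∧ v i = 0 ∧ x i = 0)) =
      Finset.univ.filter fun i => ¬ (u i = 0 ∧ v i = 0) := by
    ext i
    simp only [Finset.mem_filter, Finset.mem_univ, true_and]
    exact not_congr ⟨fun h => ⟨h.1, h.2.1⟩, fun h => ⟨h.1, h.2, hxZ i h⟩⟩
  have hus : u ∈ Submodule.span (ZMod 2) {u, v} := Submodule.subset_span (by simp)
  have hvs : v ∈ Submodule.span (ZMod 2) {u, v} := Submodule.subset_span (by simp)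
  have hge : ∀ y ∈ Submodule.span (ZMod 2) {u, v}, y ∈ K → 10 ≤ hammingNorm (x + y) := by
    intro y hy hyK
    refine hK.ten_le _ (K.add_mem (hD hx) hyK) fun h => hxn ?_
    rw [CharTwo.add_eq_zero.1 h]
    exact hy
  have h5 := hge 0 (Submodule.zero_mem _) K.zero_mem
  have h6 := hge u hus hu
  have h7 := hge v hvs hv
  have h8 := hge (u + v) (Submodule.add_mem _ hus hvs) (K.add_mem hu hv)
  rw [add_zero] at h5
  rw [h4] at h3
  omega

lemma exists_pair {K : Submodule (ZMod 2) (Fin 21 → ZMod 2)} (hK : IsCode K 5)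
    (hwt : ∀ c ∈ K, c ≠ 0 → hammingNorm c = 10 ∨ hammingNorm c = 12 ∨ hammingNorm c = 14)
    {u v t : Fin 21 → ZMod 2} (hu : u ∈ K) (hv : v ∈ K) (ht : t ∈ K) (hu14 : hammingNorm u = 14)
    (hv14 : hammingNorm v = 14) (ht14 : hammingNorm t = 14) (huv : u ≠ v) (hut : u ≠ t)
    (hvt : v ≠ t) :
    ∃ u ∈ K, ∃ v ∈ K, hammingNorm u = 14 ∧ hammingNorm v = 14 ∧ hammingNorm (u + v) = 14 := by
  by_contra! hcon
  have key : ∀ a ∈ K, ∀ b ∈ K, hammingNorm a = 14 → hammingNorm b = 14 → a ≠ b →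
      hammingNorm (a + b) = 12 := by
    intro a ha b hb ha14 hb14 hab
    have h1 := hwt (a + b) (K.add_mem ha hb) fun h => hab (CharTwo.add_eq_zero.1 h)
    have h2 := norm_add_ne_ten hK ha hb ha14 hb14
    have h3 := hcon a ha b hb ha14 hb14
    omega
  have h1 := key u hu v hv hu14 hv14 huv
  have h2 := key t ht u hu ht14 hu14 hut.symm
  have h3 := key t ht v hv ht14 hv14 hvt.symm
  have h4 := hK.ten_le (t + (u + v)) (K.add_mem ht (K.add_mem hu hv)) fun h => by
    rw [CharTwo.add_eq_zero.1 h] at ht14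
    omega
  have h5 := norm_sum_three u v t
  have h6 := Finset.card_le_univ (Finset.univ.filter fun i => ¬ (u i = 0 ∧ v i = 0 ∧ t i = 0))
  rw [Fintype.card_fin] at h6
  omega

lemma exists_perm_columnsTwo {K : Submodule (ZMod 2) (Fin 21 → ZMod 2)} (hK : IsCode K 5)
    (hwt : ∀ c ∈ K, c ≠ 0 → hammingNorm c = 10 ∨ hammingNorm c = 12 ∨ hammingNorm c = 14)
    {u v : Fin 21 → ZMod 2} (hu : u ∈ K) (hv : v ∈ K) (hu14 : hammingNorm u = 14)
    (hv14 : hammingNorm v = 14) (huv14 : hammingNorm (u + v) = 14) :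
    ∃ e : Equiv.Perm (Fin 21), ∀ j, columns columnsTwo j ∘ e ∈ K := by
  classical
  have hdot : ∀ x y : Fin 21 → ZMod 2, (hammingNorm (x * y) : ZMod 2) = ∑ i, x i * y i :=
    fun x y => norm_cast_eq _
  obtain ⟨D, hD, hDr, hD0⟩ := exists_finrank_ker K (k := 3) (LinearMap.pi
    ![∑ i, u i • LinearMap.proj i, ∑ i, v i • LinearMap.proj i]) (by rw [hK.finrank])
  have hDu : ∀ x ∈ D, Even (hammingNorm (x * u)) := by
    intro x hx
    have := congrFun (hD0 x hx) 0
    simp only [LinearMap.pi_apply, Matrix.cons_val_zero, LinearMap.sum_apply, LinearMap.smul_apply,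
      LinearMap.proj_apply, smul_eq_mul, Pi.zero_apply] at this
    rw [even_norm_iff, ← this]
    exact Finset.sum_congr rfl fun i _ => mul_comm _ _
  have hDv : ∀ x ∈ D, Even (hammingNorm (x * v)) := by
    intro x hx
    have := congrFun (hD0 x hx) 1
    simp only [LinearMap.pi_apply, Matrix.cons_val_one, Matrix.cons_val_fin_one,
      LinearMap.sum_apply, LinearMap.smul_apply,
      LinearMap.proj_apply, smul_eq_mul, Pi.zero_apply] at this
    rw [even_norm_iff, ← this]
    exact Finset.sum_congr rfl fun i _ => mul_comm _ _
  have hDuv : ∀ x ∈ D, Even (hammingNorm (x * (u + v))) := by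
    intro x hx
    have h1 := (even_norm_iff _).1 (hDu x hx)
    have h2 := (even_norm_iff _).1 (hDv x hx)
    rw [even_norm_iff]
    simp only [Pi.mul_apply, Pi.add_apply, mul_add, Finset.sum_add_distrib] at h1 h2 ⊢
    rw [h1, h2, add_zero]
  have hov := norm_add_add u v
  have huv7 : hammingNorm (u * v) = 7 := by omega
  have hnu : u ∉ D := fun h => by
    have := hDv u h
    rw [huv7] at this
    exact absurd this (by decide)
  have hnv : v ∉ D := fun h => by
    have := hDu v h
    rw [mul_comm, huv7] at this
    exact absurd this (by decide)
  have hnuv : u + v ∉ D := fun h => by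
    have h1 := norm_add_add (u + v) v
    rw [add_assoc, CharTwo.add_self_eq_zero, add_zero] at h1
    obtain ⟨a, ha⟩ := hDv _ h
    omega
  have h12 : ∀ x ∈ D, x ≠ 0 → hammingNorm x = 12 := by
    intro x hx hx0
    have hne : ∀ y, y ∉ D → x + y ≠ 0 := fun y hy h => hy (CharTwo.add_eq_zero.1 h ▸ hx)
    have h1 := hwt x (hD hx) hx0
    have h2 := hwt _ (K.add_mem (hD hx) hu) (hne u hnu)
    have h3 := hwt _ (K.add_mem (hD hx) hv) (hne v hnv)
    have h4 := hwt _ (K.add_mem (hD hx) (K.add_mem hu hv)) (hne _ hnuv)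
    have h5 := norm_sum_three u v x
    have h6 := Finset.card_le_univ (Finset.univ.filter fun i => ¬ (u i = 0 ∧ v i = 0 ∧ x i = 0))
    rw [Fintype.card_fin] at h6
    obtain ⟨p, hp⟩ := hDu x hx
    obtain ⟨q, hq⟩ := hDv x hx
    obtain ⟨r, hr⟩ := hDuv x hx
    have h7 := norm_add_add x u
    have h8 := norm_add_add x v
    have h9 := norm_add_add x (u + v)
    omega
  have hcovuv : ∀ i, ¬ (u i = 0 ∧ v i = 0) := by
    have h1 := norm_sum_two u v
    have h2 : (Finset.univ.filter fun i => ¬ (u i = 0 ∧ v i = 0)) = Finset.univ := by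
      rw [← Finset.card_eq_iff_eq_univ, Fintype.card_fin]
      omega
    intro i
    have := h2 ▸ Finset.mem_univ i
    exact (Finset.mem_filter.1 this).2
  let b := Module.finBasisOfFinrankEq (ZMod 2) D hDr
  have hb := (Fintype.linearIndependent_iff).1 b.linearIndependent
  have hcomb : ∀ a₀ a₁ a₂ : ZMod 2, a₀ • (b 0 : Fin 21 → ZMod 2) + a₁ • (b 1 : Fin 21 → ZMod 2) +
      a₂ • (b 2 : Fin 21 → ZMod 2) = 0 → a₀ = 0 ∧ a₁ = 0 ∧ a₂ = 0 := by
    intro a₀ a₁ a₂ h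
    have h1 := hb ![a₀, a₁, a₂] (by
      apply Subtype.ext
      simpa [Fin.sum_univ_three] using h)
    exact ⟨h1 0, h1 1, h1 2⟩
  have hmem : ∀ a₀ a₁ a₂ : ZMod 2, a₀ • (b 0 : Fin 21 → ZMod 2) + a₁ • (b 1 : Fin 21 → ZMod 2) +
      a₂ • (b 2 : Fin 21 → ZMod 2) ∈ D := fun a₀ a₁ a₂ =>
    D.add_mem (D.add_mem (D.smul_mem _ (b 0).2) (D.smul_mem _ (b 1).2)) (D.smul_mem _ (b 2).2)
  have hnorm : ∀ a₀ a₁ a₂ : ZMod 2, ¬ (a₀ = 0 ∧ a₁ = 0 ∧ a₂ = 0) →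
      hammingNorm (a₀ • (b 0 : Fin 21 → ZMod 2) + a₁ • (b 1 : Fin 21 → ZMod 2) +
        a₂ • (b 2 : Fin 21 → ZMod 2)) = 12 :=
    fun a₀ a₁ a₂ h => h12 _ (hmem a₀ a₁ a₂) fun h0 => h (hcomb _ _ _ h0)
  have hcovx : ∀ i, ¬ ((b 0 : Fin 21 → ZMod 2) i = 0 ∧ (b 1 : Fin 21 → ZMod 2) i = 0 ∧
      (b 2 : Fin 21 → ZMod 2) i = 0) := by
    have h1 := norm_sum_three (b 0 : Fin 21 → ZMod 2) (b 1) (b 2)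
    have e1 := hnorm 1 0 0 (by decide)
    have e2 := hnorm 0 1 0 (by decide)
    have e3 := hnorm 1 1 0 (by decide)
    have e4 := hnorm 0 0 1 (by decide)
    have e5 := hnorm 1 0 1 (by decide)
    have e6 := hnorm 0 1 1 (by decide)
    have e7 := hnorm 1 1 1 (by decide)
    simp only [one_smul, zero_smul, add_zero, zero_add] at e1 e2 e3 e4 e5 e6 e7
    rw [add_comm] at e5 e6 e7
    rw [e1, e2, e3, e4, e5, e6, e7] at h1
    have h2 : (Finset.univ.filter fun i => ¬ ((b 0 : Fin 21 → ZMod 2) i = 0 ∧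
        (b 1 : Fin 21 → ZMod 2) i = 0 ∧ (b 2 : Fin 21 → ZMod 2) i = 0)) = Finset.univ := by
      rw [← Finset.card_eq_iff_eq_univ, Fintype.card_fin]
      omega
    intro i
    have := h2 ▸ Finset.mem_univ i
    exact (Finset.mem_filter.1 this).2
  let g : Fin 5 → Fin 21 → ZMod 2 := ![b 0, b 1, b 2, u, v]
  have hg : ∀ j, g j ∈ K := by
    intro j
    fin_cases j
    exacts [hD (b 0).2, hD (b 1).2, hD (b 2).2, hu, hv]
  have hli : LinearIndependent (ZMod 2) g := by
    rw [Fintype.linearIndependent_iff]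
    intro a ha
    rw [Fin.sum_univ_five] at ha
    change a 0 • (b 0 : Fin 21 → ZMod 2) + a 1 • (b 1 : Fin 21 → ZMod 2) +
      a 2 • (b 2 : Fin 21 → ZMod 2) + a 3 • u + a 4 • v = 0 at ha
    rw [add_assoc, CharTwo.add_eq_zero] at ha
    have hin := hmem (a 0) (a 1) (a 2)
    obtain ⟨h3, h4⟩ : a 3 = 0 ∧ a 4 = 0 := by
      rw [ha] at hin
      rcases zmod_two_cases (a 3) with h3 | h3 <;> rcases zmod_two_cases (a 4) with h4 | h4 <;>
        simp only [h3, h4, zero_smul, one_smul, zero_add, add_zero] at hin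
      · exact ⟨h3, h4⟩
      · exact absurd hin hnv
      · exact absurd hin hnu
      · exact absurd hin hnuv
    rw [h3, h4, zero_smul, zero_smul, add_zero] at ha
    obtain ⟨h0, h1, h2⟩ := hcomb _ _ _ ha
    intro j
    fin_cases j
    exacts [h0, h1, h2, h3, h4]
  obtain ⟨e, he⟩ := exists_perm hK g hg hli (columns columnsTwo) fun i => by
    have key : ∀ a b c d e : ZMod 2, ¬ (a = 0 ∧ b = 0 ∧ c = 0) → ¬ (d = 0 ∧ e = 0) →
        ∃ p, ∀ j, ![a, b, c, d, e] j = columns columnsTwo j p := by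
      decide +kernel
    obtain ⟨p, hp⟩ := key _ _ _ _ _ (hcovx i) (hcovuv i)
    refine ⟨p, fun j => ?_⟩
    rw [← hp]
    fin_cases j <;> rfl
  exact ⟨e, fun j => he j ▸ hg j⟩

lemma exists_perm_columns {K : Submodule (ZMod 2) (Fin 21 → ZMod 2)} (hK : IsCode K 5) :
    ∃ e : Equiv.Perm (Fin 21), (∀ j, columns columnsOne j ∘ e ∈ K) ∨
      ∀ j, columns columnsTwo j ∘ e ∈ K := by
  rcases weight_cases hK with ⟨w, hw, h16⟩ |
      ⟨hwt, u, hu, v, hv, t, ht, hu14, hv14, ht14, huv, hut, hvt⟩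
  · obtain ⟨e, he⟩ := exists_perm_columnsOne hK hw h16
    exact ⟨e, Or.inl he⟩
  · obtain ⟨u, hu, v, hv, hu14, hv14, huv14⟩ :=
      exists_pair hK hwt hu hv ht hu14 hv14 ht14 huv hut hvt
    obtain ⟨e, he⟩ := exists_perm_columnsTwo hK hwt hu hv hu14 hv14 huv14
    exact ⟨e, Or.inr he⟩

/-- All sums of the binary vectors in a list, encoded by natural numbers. -/
def sums : List ℕ → List ℕ
  | [] => [0]
  | r :: l => sums l ++ (sums l).map (r ^^^ ·)

/-- The number of ones among the `n` lowest binary digits. -/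
def popcount : ℕ → ℕ → ℕ
  | 0, _ => 0
  | n + 1, N => popcount n N + (N.testBit n).toNat

/-- The set of all `i < 2 ^ n` with at least `t` ones, encoded by a natural number. -/
def heavy : ℕ → ℕ → ℕ
  | n, 0 => 2 ^ 2 ^ n - 1
  | 0, _ + 1 => 0
  | n + 1, t + 1 => heavy n (t + 1) ||| heavy n t <<< 2 ^ n

/-- The set of all `i < 2 ^ n` whose binary digit `j` vanishes. -/
def digitZero (j : ℕ) : ℕ → ℕ
  | 0 => 1
  | n + 1 => bif n.beq j then digitZero j n else
      (digitZero j n).lor ((digitZero j n).shiftLeft (Nat.pow 2 n))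

/-- The image of a set of numbers below `2 ^ 16` under flipping the binary digit `j`. -/
def flipDigit (j m : ℕ) : ℕ :=
  ((m.shiftRight (Nat.pow 2 j)).land (digitZero j 16)).lor
    ((m.land (digitZero j 16)).shiftLeft (Nat.pow 2 j))

/-- The image of a set of numbers below `2 ^ 16` under addition of `a % 2 ^ j`. -/
def translateSet (a : ℕ) : ℕ → ℕ → ℕ
  | 0, m => m
  | j + 1, m => translateSet a j (bif a.testBit j then flipDigit j m else m)

/-- The set of all `x < 2 ^ 16` such that the coset of `x` has minimum weight at least `t`. -/
def deep (t : ℕ) : List ℕ → ℕ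
  | [] => 2 ^ 2 ^ 16 - 1
  | c :: l => translateSet c 16 (heavy 16 (t - popcount 5 (c >>> 16))) &&& deep t l

/-- The list of the elements of `m`, each shifted by `a`, put in front of `l`. -/
def elements : ℕ → ℕ → ℕ → List ℕ → List ℕ
  | 0, a, m, l => bif m.beq 0 then l else a :: l
  | n + 1, a, m, l => bif m.beq 0 then l else
      elements n (a.xor (Nat.pow 2 n)) (m.shiftRight (Nat.pow 2 n))
        (elements n a (m.mod (Nat.pow 2 (Nat.pow 2 n))) l)

/-- Whether every sum of two elements of the list that lies in `g` is equal to `a`. -/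
def checkPairs (g a : ℕ) : List ℕ → Bool
  | [] => true
  | b :: l => (b :: l).all (fun d => (((g.shiftRight (b.xor d)).mod 2).beq 0).or ((b.xor d).beq a))
      && checkPairs g a l

/-- Search over the elements `a` of `A`, where `h` is the translate of `g` by the higher digits. -/
def checkTriples (g : ℕ) : ℕ → ℕ → ℕ → ℕ → Bool
  | 0, a, A, h => (A.beq 0).or
      (checkPairs g a (elements 16 0 ((g.land h).mod (Nat.pow 2 a)) []))
  | n + 1, a, A, h => (A.beq 0).or
      ((checkTriples g n a (A.mod (Nat.pow 2 (Nat.pow 2 n))) h).and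
        (checkTriples g n (a.xor (Nat.pow 2 n)) (A.shiftRight (Nat.pow 2 n)) (flipDigit n h)))

lemma xor_two_pow_eq_add {i j : ℕ} (h : i.testBit j = false) : i ^^^ 2 ^ j = i + 2 ^ j := by
  have hr : i % 2 ^ j < 2 ^ j := Nat.mod_lt _ (Nat.two_pow_pos j)
  have hi := Nat.div_add_mod i (2 ^ j)
  have hq : i / 2 ^ j % 2 = 0 := by
    rw [Nat.testBit_eq_decide_div_mod_eq] at h
    simpa using h
  apply Nat.eq_of_testBit_eq
  intro k
  have h2 : i + 2 ^ j = 2 ^ j * (i / 2 ^ j + 1) + i % 2 ^ j := by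
    rw [Nat.mul_add]; omega
  rw [Nat.testBit_xor, h2, Nat.testBit_two_pow_mul_add _ hr, Nat.testBit_two_pow]
  split_ifs with hk
  · rw [Nat.testBit_mod_two_pow]
    have : j ≠ k := by omega
    simp [hk, this]
  · obtain ⟨m, rfl⟩ := Nat.exists_eq_add_of_le (not_lt.1 hk)
    have e : (i.testBit (j + m)) = (i / 2 ^ j).testBit m := by
      rw [Nat.testBit_div_two_pow]; congr 1; omega
    rw [e, Nat.add_sub_cancel_left]
    cases m with
    | zero =>
      have : (i / 2 ^ j + 1) % 2 = 1 := by omega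
      simp [Nat.testBit_zero, hq, this]
    | succ m =>
      rw [Nat.testBit_succ, Nat.testBit_succ]
      have : (i / 2 ^ j + 1) / 2 = i / 2 ^ j / 2 := by omega
      simp [this]

lemma xor_two_pow_add_eq {i j : ℕ} (h : i.testBit j = true) : (i ^^^ 2 ^ j) + 2 ^ j = i := by
  rw [← xor_two_pow_eq_add (by simp [h, Nat.testBit_two_pow_self]), Nat.xor_assoc, Nat.xor_self,
    Nat.xor_zero]

lemma lt_two_pow_succ_cases {i n : ℕ} (h : i < 2 ^ (n + 1)) :
    i < 2 ^ n ∨ ∃ k < 2 ^ n, i = 2 ^ n + k := by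
  rw [pow_succ] at h
  by_cases hi : i < 2 ^ n
  · exact Or.inl hi
  · exact Or.inr ⟨i - 2 ^ n, by omega, by omega⟩

lemma popcount_congr {n a b : ℕ} (h : ∀ j < n, a.testBit j = b.testBit j) :
    popcount n a = popcount n b := by
  induction n with
  | zero => rfl
  | succ n ih => rw [popcount, popcount, ih fun j hj => h j (by omega), h n (by omega)]

lemma testBit_heavy {n t i : ℕ} (hi : i < 2 ^ n) (ht : t ≤ popcount n i) :
    (heavy n t).testBit i = true := by
  induction n generalizing t i with
  | zero =>
    obtain rfl : t = 0 := by simpa [popcount] using ht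
    rw [heavy, Nat.testBit_two_pow_sub_one]
    simpa using hi
  | succ n ih =>
    cases t with
    | zero =>
      rw [heavy, Nat.testBit_two_pow_sub_one]
      simpa using hi
    | succ t =>
      rw [heavy, Nat.testBit_or, Bool.or_eq_true]
      rcases lt_two_pow_succ_cases hi with h | ⟨k, hk, rfl⟩
      · left
        rw [popcount, Nat.testBit_lt_two_pow h] at ht
        exact ih h (by simpa using ht)
      · right
        rw [popcount, popcount_congr (b := k) fun j hj => Nat.testBit_two_pow_add_gt hj k,
          Nat.testBit_two_pow_add_eq, Nat.testBit_lt_two_pow hk] at ht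
        rw [Nat.testBit_shiftLeft, Nat.add_sub_cancel_left, ih hk (by simpa using ht)]
        simp

lemma testBit_digitZero {j n i : ℕ} (hi : i < 2 ^ n) (hj : i.testBit j = false) :
    (digitZero j n).testBit i = true := by
  induction n generalizing i with
  | zero =>
    obtain rfl : i = 0 := by simpa using hi
    simp [digitZero]
  | succ n ih =>
    rw [digitZero]
    by_cases hn : n = j
    · subst hn
      rcases lt_two_pow_succ_cases hi with h | ⟨k, hk, rfl⟩
      · simpa using ih h hj
      · rw [Nat.testBit_two_pow_add_eq, Nat.testBit_lt_two_pow hk] at hj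
        simp at hj
    · have hb : n.beq j = false := by
        rw [← Bool.not_eq_true]
        exact fun h => hn (Nat.eq_of_beq_eq_true h)
      rw [hb, cond_false]
      change (digitZero j n ||| digitZero j n <<< 2 ^ n).testBit i = true
      rw [Nat.testBit_or, Bool.or_eq_true]
      rcases lt_two_pow_succ_cases hi with h | ⟨k, hk, rfl⟩
      · exact Or.inl (ih h hj)
      · right
        rw [Nat.testBit_shiftLeft, Nat.add_sub_cancel_left, ih hk]
        · simp
        · rw [← hj]
          rcases lt_or_gt_of_ne hn with h | h
          · rw [Nat.testBit_lt_two_pow (hk.trans (Nat.pow_lt_pow_right (by norm_num) h)),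
              Nat.testBit_lt_two_pow]
            exact hi.trans_le (Nat.pow_le_pow_right (by norm_num) h)
          · rw [Nat.testBit_two_pow_add_gt h]

lemma testBit_flipDigit {j m i : ℕ} (hi : i < 2 ^ 16) (h : m.testBit (i ^^^ 2 ^ j) = true) :
    (flipDigit j m).testBit i = true := by
  change (((m >>> 2 ^ j) &&& digitZero j 16)
      ||| ((m &&& digitZero j 16) <<< 2 ^ j)).testBit i = true
  rw [Nat.testBit_or, Bool.or_eq_true]
  by_cases hj : i.testBit j = true
  · right
    have h2 := xor_two_pow_add_eq hj
    have h1 : i - 2 ^ j = i ^^^ 2 ^ j := by omega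
    rw [Nat.testBit_shiftLeft, h1, Nat.testBit_and, h,
        testBit_digitZero ((Nat.le.intro h2).trans_lt hi)]
    · simp only [Bool.and_true, decide_eq_true_eq]; omega
    · simp [hj, Nat.testBit_two_pow_self]
  · left
    rw [Bool.not_eq_true] at hj
    rw [xor_two_pow_eq_add hj, add_comm] at h
    rw [Nat.testBit_and, Nat.testBit_shiftRight, h, testBit_digitZero hi hj, Bool.true_and]

lemma testBit_translateSet {a j m i : ℕ} (hi : i < 2 ^ 16) (hj : j ≤ 16)
    (h : m.testBit (i ^^^ (a % 2 ^ j)) = true) : (translateSet a j m).testBit i = true := by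
  induction j generalizing m with
  | zero => simpa [translateSet, Nat.mod_one] using h
  | succ j ih =>
    have h2 : i ^^^ (a % 2 ^ j) < 2 ^ 16 := by
      refine Nat.xor_lt_two_pow hi ((Nat.mod_lt _ (Nat.two_pow_pos j)).trans_le ?_)
      exact Nat.pow_le_pow_right (by norm_num) (by omega)
    rw [translateSet]
    apply ih (by omega)
    by_cases hb : a.testBit j = true
    · rw [hb, cond_true]
      apply testBit_flipDigit h2
      convert h using 2
      rw [Nat.xor_assoc]
      congr 1
      apply Nat.eq_of_testBit_eq
      intro k
      rw [Nat.testBit_xor, Nat.testBit_mod_two_pow, Nat.testBit_mod_two_pow, Nat.testBit_two_pow]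
      rcases lt_trichotomy k j with hk | rfl | hk
      · have h3 : j ≠ k := by omega
        have h4 : k < j + 1 := by omega
        simp [hk, h3, h4]
      · simp [hb]
      · have h3 : j ≠ k := by omega
        have h4 : ¬ k < j + 1 := by omega
        have h5 : ¬ k < j := by omega
        simp [h3, h4, h5]
    · rw [Bool.not_eq_true] at hb
      rw [hb, cond_false]
      convert h using 3
      apply Nat.eq_of_testBit_eq
      intro k
      rw [Nat.testBit_mod_two_pow, Nat.testBit_mod_two_pow]
      rcases eq_or_ne k j with rfl | hk
      · simp [hb]
      · have : k < j ↔ k < j + 1 := by omega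
        simp [this]

lemma testBit_deep {t : ℕ} {l : List ℕ} {x : ℕ} (hx : x < 2 ^ 16)
    (h : ∀ c ∈ l, t ≤ popcount 21 (x ^^^ c)) : (deep t l).testBit x = true := by
  induction l with
  | nil => rw [deep, Nat.testBit_two_pow_sub_one]; simpa using hx
  | cons c l ih =>
    rw [deep, Nat.testBit_and, ih fun c hc => h c (List.mem_cons_of_mem _ hc), Bool.and_true]
    refine testBit_translateSet hx le_rfl (testBit_heavy ?_ ?_)
    · exact Nat.xor_lt_two_pow hx (Nat.mod_lt _ (Nat.two_pow_pos 16))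
    · have h1 := h c List.mem_cons_self
      have h2 : popcount 16 (x ^^^ c % 2 ^ 16) = popcount 16 (x ^^^ c) :=
        popcount_congr fun j hj => by
          rw [Nat.testBit_xor, Nat.testBit_xor, Nat.testBit_mod_two_pow, decide_eq_true hj,
            Bool.true_and]
      have h3 : popcount 21 (x ^^^ c) = popcount 16 (x ^^^ c) + popcount 5 (c >>> 16) := by
        have h4 : ∀ k, x.testBit (16 + k) = false := fun k => Nat.testBit_lt_two_pow
          (hx.trans_le (Nat.pow_le_pow_right (by norm_num) (by omega)))
        have h5 := h4 0
        have h6 := h4 1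
        have h7 := h4 2
        have h8 := h4 3
        have h9 := h4 4
        norm_num at h5 h6 h7 h8 h9
        simp only [popcount, Nat.testBit_shiftRight, Nat.testBit_xor]
        norm_num [h5, h6, h7, h8, h9]
        omega
      omega

lemma mem_elements_of_mem {n a m : ℕ} {l : List ℕ} {x : ℕ} (hx : x ∈ l) :
    x ∈ elements n a m l := by
  induction n generalizing a m l with
  | zero => rw [elements]; cases m.beq 0 <;> simp [hx]
  | succ n ih =>
    rw [elements]
    cases m.beq 0
    · exact ih (ih hx)
    · exact hx

lemma beq_zero_eq_false {m i : ℕ} (h : m.testBit i = true) : m.beq 0 = false := by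
  rw [← Bool.not_eq_true]
  intro h2
  rw [Nat.eq_of_beq_eq_true h2] at h
  simp at h

lemma xor_two_pow_add {a n k : ℕ} (hk : k < 2 ^ n) : a ^^^ (2 ^ n + k) = (a ^^^ 2 ^ n) ^^^ k := by
  rw [Nat.xor_assoc, Nat.xor_comm (2 ^ n) k, xor_two_pow_eq_add (Nat.testBit_lt_two_pow hk),
    add_comm]

lemma mem_elements {n a m : ℕ} {l : List ℕ} {i : ℕ} (hi : i < 2 ^ n) (hm : m.testBit i = true) :
    a ^^^ i ∈ elements n a m l := by
  induction n generalizing a m l i with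
  | zero =>
    obtain rfl : i = 0 := by simpa using hi
    rw [elements, beq_zero_eq_false hm]
    simp
  | succ n ih =>
    rw [elements, beq_zero_eq_false hm, cond_false]
    rcases lt_two_pow_succ_cases hi with h | ⟨k, hk, rfl⟩
    · refine mem_elements_of_mem (ih h ?_)
      change (m % 2 ^ 2 ^ n).testBit i = true
      rw [Nat.testBit_mod_two_pow, hm, decide_eq_true h, Bool.and_true]
    · rw [xor_two_pow_add hk]
      refine ih hk ?_
      change (m >>> 2 ^ n).testBit k = true
      rwa [Nat.testBit_shiftRight]

lemma xor_eq_of_checkPair {g a b d : ℕ}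
    (h : (((g.shiftRight (b.xor d)).mod 2).beq 0).or ((b.xor d).beq a) = true)
    (hg : g.testBit (b ^^^ d) = true) : b ^^^ d = a := by
  rcases Bool.or_eq_true_iff.1 h with h | h
  · have h1 : (g >>> (b ^^^ d)) % 2 = 0 := Nat.eq_of_beq_eq_true h
    rw [Nat.testBit_eq_decide_div_mod_eq, ← Nat.shiftRight_eq_div_pow, h1] at hg
    simp at hg
  · exact Nat.eq_of_beq_eq_true h

lemma xor_eq_of_checkPairs {g a : ℕ} {l : List ℕ} (h : checkPairs g a l = true) {b d : ℕ}
    (hb : b ∈ l) (hd : d ∈ l) (hg : g.testBit (b ^^^ d) = true) : b ^^^ d = a := by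
  induction l with
  | nil => simp at hb
  | cons c l ih =>
    rw [checkPairs, Bool.and_eq_true, List.all_eq_true] at h
    rcases List.mem_cons.1 hb with rfl | hb'
    · exact xor_eq_of_checkPair (h.1 d hd) hg
    · rcases List.mem_cons.1 hd with rfl | hd'
      · rw [Nat.xor_comm] at hg ⊢
        exact xor_eq_of_checkPair (h.1 b hb) hg
      · exact ih h.2 hb' hd'

lemma xor_eq_of_checkTriples {g n a A h : ℕ} (hn : n ≤ 16) (ha : a < 2 ^ 16)
    (hc : checkTriples g n a A h = true)
    (hh : ∀ y < 2 ^ 16, g.testBit (y ^^^ a) = true → h.testBit y = true) {i : ℕ} (hi : i < 2 ^ n)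
    (hA : A.testBit i = true) {y z : ℕ} (hy : y < a ^^^ i) (hz : z < a ^^^ i)
    (hgy : g.testBit y = true) (hgz : g.testBit z = true)
    (hya : g.testBit (y ^^^ (a ^^^ i)) = true) (hza : g.testBit (z ^^^ (a ^^^ i)) = true)
    (hyz : g.testBit (y ^^^ z) = true) : y ^^^ z = a ^^^ i := by
  induction n generalizing a A h i with
  | zero =>
    obtain rfl : i = 0 := by simpa using hi
    rw [checkTriples, beq_zero_eq_false hA, Bool.false_or] at hc
    rw [Nat.xor_zero] at *
    have key : ∀ x, x < a → g.testBit x = true → g.testBit (x ^^^ a) = true →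
        x ∈ elements 16 0 ((g.land h).mod (Nat.pow 2 a)) [] := by
      intro x hx h1 h2
      rw [← Nat.zero_xor x]
      refine mem_elements (hx.trans ha) ?_
      change ((g &&& h) % 2 ^ a).testBit x = true
      rw [Nat.testBit_mod_two_pow, Nat.testBit_and, h1, hh x (hx.trans ha) h2, decide_eq_true hx]
      rfl
    exact xor_eq_of_checkPairs hc (key y hy hgy hya) (key z hz hgz hza) hyz
  | succ n ih =>
    have hn2 : 2 ^ n < 2 ^ 16 := Nat.pow_lt_pow_right (by norm_num) (by omega)
    rw [checkTriples, beq_zero_eq_false hA, Bool.false_or] at hc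
    obtain ⟨hc1, hc2⟩ := Bool.and_eq_true_iff.1 hc
    rcases lt_two_pow_succ_cases hi with hin | ⟨k, hk, rfl⟩
    · refine ih (by omega) ha hc1 hh hin ?_ hy hz hya hza
      change (A % 2 ^ 2 ^ n).testBit i = true
      rw [Nat.testBit_mod_two_pow, hA, decide_eq_true hin, Bool.and_true]
    · rw [xor_two_pow_add hk] at *
      refine ih (by omega) (Nat.xor_lt_two_pow ha hn2) hc2 ?_ hk ?_ hy hz hya hza
      · intro x hx h1
        refine testBit_flipDigit hx (hh _ (Nat.xor_lt_two_pow hx hn2) ?_)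
        rw [← h1]
        congr 1
        rw [Nat.xor_assoc, Nat.xor_comm a]
      · change (A >>> 2 ^ n).testBit k = true
        rwa [Nat.testBit_shiftRight]

/-- If the digits of `g` satisfy the search condition, then three elements of `g` whose pairwise
sums lie in `g` have vanishing sum. -/
lemma xor_eq_zero_of_checkTriples {g : ℕ} (hc : checkTriples g 16 0 g g = true)
    (h0 : g.testBit 0 = false) {x y z : ℕ} (hx : x < 2 ^ 16) (hy : y < 2 ^ 16) (hz : z < 2 ^ 16)
    (hgx : g.testBit x = true) (hgy : g.testBit y = true) (hgz : g.testBit z = true)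
    (hxy : g.testBit (x ^^^ y) = true) (hxz : g.testBit (x ^^^ z) = true)
    (hyz : g.testBit (y ^^^ z) = true) : x ^^^ y ^^^ z = 0 := by
  have key : ∀ a < 2 ^ 16, ∀ b < a, ∀ d < a, g.testBit a = true → g.testBit b = true →
      g.testBit d = true → g.testBit (b ^^^ a) = true → g.testBit (d ^^^ a) = true →
      g.testBit (b ^^^ d) = true → b ^^^ d = a := by
    intro a ha b hb d hd h1 h2 h3 h4 h5 h6
    have := xor_eq_of_checkTriples le_rfl (by norm_num) hc (fun y _ h => by simpa using h)
      ha h1 (y := b) (z := d) (by simpa using hb) (by simpa using hd) h2 h3 (by simpa using h4)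
      (by simpa using h5) h6
    simpa using this
  have hne : ∀ u v, g.testBit (u ^^^ v) = true → u ≠ v := by
    rintro u _ h rfl
    rw [Nat.xor_self, h0] at h
    exact Bool.false_ne_true h
  have hyx := hxy
  have hzx := hxz
  have hzy := hyz
  rw [Nat.xor_comm] at hyx hzx hzy
  have n1 := hne _ _ hxy
  have n2 := hne _ _ hxz
  have n3 := hne _ _ hyz
  by_cases c1 : y < x ∧ z < x
  · rw [Nat.xor_assoc, key x hx y c1.1 z c1.2 hgx hgy hgz hyx hzx hyz, Nat.xor_self]
  by_cases c2 : x < y ∧ z < y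
  · rw [Nat.xor_comm x y, Nat.xor_assoc, key y hy x c2.1 z c2.2 hgy hgx hgz hxy hzy hxz,
      Nat.xor_self]
  · rw [key z hz x (by omega) y (by omega) hgz hgx hgy hxz hyz hxy, Nat.xor_self]

/-- The rows of the matrix with columns `columnsOne`. -/
def rowsOne : List ℕ := [120149, 190054, 325752, 589696, 1081343]

/-- The rows of the matrix with columns `columnsTwo`. -/
def rowsTwo : List ℕ := [517020, 588831, 1114080, 1947350, 449403]

lemma word_xor (n a b : ℕ) : word n (a ^^^ b) = word n a + word n b := by
  funext i
  rw [Pi.add_apply, word, word, word, Nat.testBit_xor]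
  cases a.testBit i <;> cases b.testBit i <;> decide

lemma word_zero (n : ℕ) : word n 0 = 0 := by
  funext i
  simp [word]

lemma norm_word (n N : ℕ) : hammingNorm (word n N) = popcount n N := by
  induction n with
  | zero => rfl
  | succ n ih =>
    rw [popcount, ← ih]
    rw [norm_eq_sum, norm_eq_sum, Fin.sum_univ_castSucc]
    congr 1
    rw [word, Fin.val_last]
    rcases Bool.eq_false_or_eq_true (N.testBit n) with h | h <;> simp [h]

lemma exists_word {n : ℕ} (x : Fin n → ZMod 2) : ∃ N < 2 ^ n, word n N = x := by
  refine ⟨_, Nat.ofBits_lt_two_pow fun i => decide (x i = 1), funext fun i => ?_⟩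
  rw [word, Nat.testBit_ofBits_lt _ _ i.2]
  rcases zmod_two_cases (x i) with h | h <;> simp [h]

lemma norm_comp_perm {n : ℕ} (x : Fin n → ZMod 2) (e : Equiv.Perm (Fin n)) :
    hammingNorm (x ∘ e) = hammingNorm x := by
  rw [norm_eq_sum, norm_eq_sum]
  exact Equiv.sum_comp e fun i => if x i ≠ 0 then 1 else 0

lemma add_self_zmod_two {n : ℕ} (x : Fin n → ZMod 2) : x + x = 0 :=
  funext fun _ => CharTwo.add_self_eq_zero _

lemma word_sums_mem {K : Submodule (ZMod 2) (Fin 21 → ZMod 2)} {e : Equiv.Perm (Fin 21)}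
    {l : List ℕ} (h : ∀ r ∈ l, word 21 r ∘ e ∈ K) {N : ℕ} (hN : N ∈ sums l) :
    word 21 N ∘ e ∈ K := by
  induction l generalizing N with
  | nil =>
    obtain rfl : N = 0 := by simpa [sums] using hN
    rw [word_zero]
    exact K.zero_mem
  | cons r l ih =>
    have ih := fun {N} => ih (N := N) fun r hr => h r (List.mem_cons_of_mem _ hr)
    rcases List.mem_append.1 hN with hN | hN
    · exact ih hN
    · obtain ⟨M, hM, rfl⟩ := List.mem_map.1 hN
      rw [word_xor]
      exact K.add_mem (h r List.mem_cons_self) (ih hM)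

lemma exists_rows {K : Submodule (ZMod 2) (Fin 21 → ZMod 2)} (hK : IsCode K 5) :
    ∃ l, (l = rowsOne ∨ l = rowsTwo) ∧ ∃ e : Equiv.Perm (Fin 21), ∀ r ∈ l, word 21 r ∘ e ∈ K := by
  have h1 : ∀ r ∈ rowsOne, ∃ j, word 21 r = columns columnsOne j := by decide
  have h2 : ∀ r ∈ rowsTwo, ∃ j, word 21 r = columns columnsTwo j := by decide
  obtain ⟨e, he | he⟩ := exists_perm_columns hK
  · refine ⟨_, Or.inl rfl, e, fun r hr => ?_⟩
    obtain ⟨j, hj⟩ := h1 r hr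
    exact hj ▸ he j
  · refine ⟨_, Or.inr rfl, e, fun r hr => ?_⟩
    obtain ⟨j, hj⟩ := h2 r hr
    exact hj ▸ he j

lemma exists_mem_sums {l : List ℕ} (hl : l = rowsOne ∨ l = rowsTwo) :
    ∀ h < 32, ∃ N ∈ sums l, N >>> 16 = h := by
  rcases hl with rfl | rfl <;> decide +kernel

lemma exists_small_representative {K : Submodule (ZMod 2) (Fin 21 → ZMod 2)}
    {e : Equiv.Perm (Fin 21)} {l : List ℕ} (hl : l = rowsOne ∨ l = rowsTwo)
    (h : ∀ r ∈ l, word 21 r ∘ e ∈ K) (x : Fin 21 → ZMod 2) :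
    ∃ X < 2 ^ 16, word 21 X ∘ e + x ∈ K := by
  obtain ⟨N, hN, hx⟩ := exists_word (x ∘ e.symm)
  have hN2 : N >>> 16 < 32 := by
    rw [Nat.shiftRight_eq_div_pow]; omega
  obtain ⟨M, hM, hMN⟩ := exists_mem_sums hl _ hN2
  refine ⟨N ^^^ M, ?_, ?_⟩
  · apply Nat.lt_pow_two_of_testBit
    intro i hi
    obtain ⟨j, rfl⟩ := Nat.exists_eq_add_of_le hi
    rw [Nat.testBit_xor, ← Nat.testBit_shiftRight, ← Nat.testBit_shiftRight, hMN, Bool.xor_self]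
  · have : word 21 (N ^^^ M) ∘ e + x = word 21 M ∘ e := by
      funext i
      have := congrFun hx (e i)
      simp only [Function.comp_apply, Equiv.symm_apply_apply] at this
      rw [word_xor, Pi.add_apply, Function.comp_apply, Pi.add_apply, this, add_comm,
        CharTwo.add_cancel_left, Function.comp_apply]
    rw [this]
    exact word_sums_mem h hM

lemma testBit_deep_of_coset {K : Submodule (ZMod 2) (Fin 21 → ZMod 2)}
    {e : Equiv.Perm (Fin 21)} {l : List ℕ} (h : ∀ r ∈ l, word 21 r ∘ e ∈ K) {t : ℕ}
    {x : Fin 21 → ZMod 2} (hx : ∀ c ∈ K, t ≤ hammingNorm (x + c)) {X : ℕ} (hX : X < 2 ^ 16)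
    (hXx : word 21 X ∘ e + x ∈ K) : (deep t (sums l)).testBit X = true := by
  refine testBit_deep hX fun c hc => ?_
  have := hx _ (K.add_mem hXx (word_sums_mem h hc))
  rw [← norm_word, ← norm_comp_perm _ e, word_xor]
  convert this using 2
  rw [add_left_comm, add_assoc, add_left_comm x, ← add_assoc x, add_self_zmod_two, zero_add]
  rfl

set_option maxRecDepth 100000 in
lemma deep_nine {l : List ℕ} (hl : l = rowsOne ∨ l = rowsTwo) : deep 9 (sums l) = 0 := by
  rcases hl with rfl | rfl <;> decide +kernel

set_option maxRecDepth 100000 in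
lemma testBit_deep_eight {l : List ℕ} (hl : l = rowsOne ∨ l = rowsTwo) :
    (deep 8 (sums l)).testBit 0 = false := by
  rcases hl with rfl | rfl <;> decide +kernel

set_option maxRecDepth 100000 in
lemma checkTriples_deep_eight {l : List ℕ} (hl : l = rowsOne ∨ l = rowsTwo) :
    checkTriples (deep 8 (sums l)) 16 0 (deep 8 (sums l)) (deep 8 (sums l)) = true := by
  rcases hl with rfl | rfl <;> decide +kernel

/-- The covering radius of a `[21, 5, 10]` code is at most `8`. -/
lemma exists_norm_add_le {K : Submodule (ZMod 2) (Fin 21 → ZMod 2)} (hK : IsCode K 5)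
    (x : Fin 21 → ZMod 2) : ∃ c ∈ K, hammingNorm (x + c) ≤ 8 := by
  by_contra! hx
  obtain ⟨l, hl, e, he⟩ := exists_rows hK
  obtain ⟨X, hX, hXx⟩ := exists_small_representative hl he x
  have := testBit_deep_of_coset he (t := 9) hx hX hXx
  rw [deep_nine hl, Nat.zero_testBit] at this
  exact Bool.false_ne_true this

/-- If the cosets of `x`, `y`, `z` and their pairwise sums have minimum weight at least `8`, then
the coset of `x + y + z` is trivial. -/
lemma add_add_mem {K : Submodule (ZMod 2) (Fin 21 → ZMod 2)} (hK : IsCode K 5)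
    {x y z : Fin 21 → ZMod 2} (hx : ∀ c ∈ K, 8 ≤ hammingNorm (x + c))
    (hy : ∀ c ∈ K, 8 ≤ hammingNorm (y + c)) (hz : ∀ c ∈ K, 8 ≤ hammingNorm (z + c))
    (hxy : ∀ c ∈ K, 8 ≤ hammingNorm (x + y + c)) (hxz : ∀ c ∈ K, 8 ≤ hammingNorm (x + z + c))
    (hyz : ∀ c ∈ K, 8 ≤ hammingNorm (y + z + c)) : x + y + z ∈ K := by
  obtain ⟨l, hl, e, he⟩ := exists_rows hK
  obtain ⟨X, hX, hXx⟩ := exists_small_representative hl he x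
  obtain ⟨Y, hY, hYy⟩ := exists_small_representative hl he y
  obtain ⟨Z, hZ, hZz⟩ := exists_small_representative hl he z
  have key : ∀ {A B : ℕ} {a b : Fin 21 → ZMod 2}, word 21 A ∘ e + a ∈ K → word 21 B ∘ e + b ∈ K →
      word 21 (A ^^^ B) ∘ e + (a + b) ∈ K := by
    intro A B a b ha hb
    rw [word_xor]
    convert K.add_mem ha hb using 1
    exact add_add_add_comm _ _ _ _
  have := xor_eq_zero_of_checkTriples (checkTriples_deep_eight hl) (testBit_deep_eight hl) hX hY hZ
    (testBit_deep_of_coset he hx hX hXx) (testBit_deep_of_coset he hy hY hYy)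
    (testBit_deep_of_coset he hz hZ hZz)
    (testBit_deep_of_coset he hxy (Nat.xor_lt_two_pow hX hY) (key hXx hYy))
    (testBit_deep_of_coset he hxz (Nat.xor_lt_two_pow hX hZ) (key hXx hZz))
    (testBit_deep_of_coset he hyz (Nat.xor_lt_two_pow hY hZ) (key hYy hZz))
  have h := key (key hXx hYy) hZz
  rw [this, word_zero] at h
  convert h using 1
  exact (zero_add (x + y + z)).symm

lemma norm_eq_norm_comp_add {m n : ℕ} (f : Fin m ↪ Fin n) {T : Finset (Fin n)}
    (hT : ∀ i, i ∈ T ↔ i ∉ Set.range f) (v : Fin n → ZMod 2) :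
    hammingNorm v = hammingNorm (v ∘ f) + ∑ i ∈ T, if v i ≠ 0 then 1 else 0 := by
  have : Finset.univ.map f = Tᶜ := by
    ext i
    simp [hT]
  rw [norm_eq_sum, norm_eq_sum, ← Finset.sum_compl_add_sum T, ← this, Finset.sum_map]
  rfl

lemma IsCode.ten_le_norm_add {m n k : ℕ} {C : Submodule (ZMod 2) (Fin n → ZMod 2)}
    (hC : IsCode C k) (f : Fin m ↪ Fin n) {T : Finset (Fin n)}
    (hT : ∀ i, i ∈ T ↔ i ∉ Set.range f) {v : Fin n → ZMod 2} (hv : v ∈ C) {j : Fin n}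
    (hj : j ∈ T) (hvj : v j = 1) {c : Fin m → ZMod 2} (hc : c ∈ BinaryCode.shorten C f) :
    10 ≤ hammingNorm (v ∘ f + c) + ∑ i ∈ T, if v i ≠ 0 then 1 else 0 := by
  have h0 : ∀ i ∈ T, (v + Function.extend f c 0) i = v i := by
    intro i hi
    rw [Pi.add_apply, Function.extend_apply' _ _ _ ((hT i).1 hi), Pi.zero_apply, add_zero]
  have h := hC.ten_le _ (C.add_mem hv (mem_shorten.1 hc)) fun h => by
    have := h0 j hj
    rw [h, hvj] at this
    exact zero_ne_one this
  rw [norm_eq_norm_comp_add f hT, Finset.sum_congr rfl fun i hi => by rw [h0 i hi]] at h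
  convert h using 3
  funext i
  simp [f.injective.extend_apply]

lemma not_isCode_twentytwo_six (C : Submodule (ZMod 2) (Fin 22 → ZMod 2)) : ¬ IsCode C 6 := by
  intro hC
  by_cases hd : IsDual C {0}
  · obtain ⟨D, hD⟩ := hC.exists_shorten (m := 21) (l := 6) (Finset.singleton_nonempty 0) hd 1
      (by simp) rfl (by norm_num)
    exact not_isCode_twentyone_six D hD
  · simp only [IsDual, Finset.sum_singleton, not_forall] at hd
    obtain ⟨v, hv, hv0⟩ := hd
    have hv0 := (zmod_two_cases (v 0)).resolve_left hv0
    obtain ⟨f, hf⟩ := exists_embedding_compl (m := 21) ({0} : Finset (Fin 22)) (by simp)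
    have h1 := finrank_shorten C f hf
    have h2 := (LinearMap.range (restrict C {0})).finrank_le
    rw [hC.finrank] at h1
    rw [Module.finrank_fintype_fun_eq_card, Fintype.card_coe, Finset.card_singleton] at h2
    obtain ⟨K, hKC, hK⟩ := (hC.shorten f).mono (l := 5) (by omega)
    obtain ⟨c, hc, hle⟩ := exists_norm_add_le hK (v ∘ f)
    have h := hC.ten_le_norm_add f hf hv (Finset.mem_singleton_self 0) hv0 (hKC hc)
    rw [Finset.sum_singleton, hv0] at h
    norm_num at h
    omega

lemma exists_mem_of_sum_eq_zero {m n k : ℕ} {C : Submodule (ZMod 2) (Fin n → ZMod 2)}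
    (hC : IsCode C k) (f : Fin m ↪ Fin n) {S : Finset (Fin n)}
    (hS : ∀ i, i ∈ S ↔ i ∉ Set.range f) (hne : S.Nonempty) (hd : IsDual C S)
    (hk : S.card + Module.finrank (ZMod 2) (shorten C f) ≤ k + 1) {w : Fin n → ZMod 2}
    (hw : ∑ i ∈ S, w i = 0) : ∃ v ∈ C, ∀ i ∈ S, v i = w i := by
  have h1 := finrank_shorten C f hS
  have h2 := finrank_ker_parityOn (Finset.Subset.refl S) hne
  have h3 := Submodule.finrank_mono (range_restrict_le (Finset.Subset.refl S) hd)
  rw [hC.finrank] at h1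
  have h4 := Submodule.eq_of_le_of_finrank_eq (range_restrict_le (Finset.Subset.refl S) hd)
    (by omega)
  have h5 : (fun i : S => w i) ∈ LinearMap.ker (parityOn S S) := by
    rw [LinearMap.mem_ker, parityOn_apply (Finset.Subset.refl S), hw]
  rw [← h4] at h5
  obtain ⟨v, hv⟩ := h5
  exact ⟨v, v.2, fun i hi => congrFun hv ⟨i, hi⟩⟩

lemma not_isCode_twentyfive_eight (C : Submodule (ZMod 2) (Fin 25 → ZMod 2)) : ¬ IsCode C 8 := by
  intro hC
  obtain ⟨S, hS0, hS4, hd⟩ := hC.exists_dual_card_le_four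
  have hne : S.Nonempty := Finset.card_pos.1 (by omega)
  rcases Nat.lt_or_ge S.card 4 with hlt | hge
  · obtain ⟨D, hD⟩ := hC.exists_shorten (m := 22) (l := 6) hne hd 3 (by omega) rfl (by norm_num)
    exact not_isCode_twentytwo_six D hD
  have hcard : S.card = 4 := le_antisymm hS4 hge
  obtain ⟨f, hf⟩ := exists_embedding_compl (m := 21) S (by omega)
  have h1 := finrank_shorten C f hf
  have h2 := finrank_ker_parityOn (Finset.Subset.refl S) hne
  have h3 := Submodule.finrank_mono (range_restrict_le (Finset.Subset.refl S) hd)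
  have h4 : Module.finrank (ZMod 2) (shorten C f) < 6 := by
    by_contra! h
    obtain ⟨D, -, hD⟩ := (hC.shorten f).mono h
    exact not_isCode_twentyone_six D hD
  rw [hC.finrank] at h1
  have h5 : Module.finrank (ZMod 2) (shorten C f) = 5 := by omega
  have hK : IsCode (shorten C f) 5 := h5 ▸ hC.shorten f
  obtain ⟨a, b, c, d, hab, hac, had, hbc, hbd, hcd, hS⟩ := Finset.card_eq_four.1 hcard
  have hsum : ∀ {M : Type} [AddCommMonoid M] (g : Fin 25 → M),
      ∑ i ∈ S, g i = g a + (g b + (g c + g d)) := by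
    intro M _ g
    rw [hS, Finset.sum_insert (by simp [hab, hac, had]), Finset.sum_insert (by simp [hbc, hbd]),
      Finset.sum_pair hcd]
  have haS : a ∈ S := by simp [hS]
  have hbS : b ∈ S := by simp [hS]
  have hcS : c ∈ S := by simp [hS]
  have hdS : d ∈ S := by simp [hS]
  have hex : ∀ α β γ δ : ZMod 2, α + (β + (γ + δ)) = 0 →
      ∃ v ∈ C, v a = α ∧ v b = β ∧ v c = γ ∧ v d = δ := by
    intro α β γ δ h
    let w : Fin 25 → ZMod 2 := Pi.single a α + Pi.single b β + Pi.single c γ + Pi.single d δ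
    have wa : w a = α := by simp [w, hab, hac, had]
    have wb : w b = β := by simp [w, hab.symm, hbc, hbd]
    have wc : w c = γ := by simp [w, hac.symm, hbc.symm, hcd]
    have wd : w d = δ := by simp [w, had.symm, hbd.symm, hcd.symm]
    obtain ⟨v, hv, hvw⟩ := exists_mem_of_sum_eq_zero hC f hf hne hd (by omega) (w := w)
      (by rw [hsum, wa, wb, wc, wd, h])
    exact ⟨v, hv, (hvw a haS).trans wa, (hvw b hbS).trans wb, (hvw c hcS).trans wc,
      (hvw d hdS).trans wd⟩
  obtain ⟨x, hx, xa, xb, xc, xd⟩ := hex 1 1 0 0 (by decide)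
  obtain ⟨y, hy, ya, yb, yc, yd⟩ := hex 1 0 1 0 (by decide)
  obtain ⟨z, hz, za, zb, zc, zd⟩ := hex 1 0 0 1 (by decide)
  have height : ∀ {v : Fin 25 → ZMod 2}, v ∈ C → ∀ j ∈ S, v j = 1 →
      (∑ i ∈ S, if v i ≠ 0 then 1 else 0) = 2 → ∀ u ∈ shorten C f, 8 ≤ hammingNorm (v ∘ f + u) := by
    intro v hv j hj hvj h2 u hu
    have := hC.ten_le_norm_add f hf hv hj hvj hu
    omega
  have hmem : (x + y + z) ∘ f ∈ shorten C f :=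
    add_add_mem hK (x := x ∘ f) (y := y ∘ f) (z := z ∘ f)
      (height hx a haS xa (by rw [hsum, xa, xb, xc, xd]; decide))
      (height hy a haS ya (by rw [hsum, ya, yb, yc, yd]; decide))
      (height hz a haS za (by rw [hsum, za, zb, zc, zd]; decide))
      (height (v := x + y) (C.add_mem hx hy) b hbS (by rw [Pi.add_apply, xb, yb]; decide)
        (by simp only [hsum, Pi.add_apply, xa, xb, xc, xd, ya, yb, yc, yd]; decide))
      (height (v := x + z) (C.add_mem hx hz) b hbS (by rw [Pi.add_apply, xb, zb]; decide)
        (by simp only [hsum, Pi.add_apply, xa, xb, xc, xd, za, zb, zc, zd]; decide))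
      (height (v := y + z) (C.add_mem hy hz) c hcS (by rw [Pi.add_apply, yc, zc]; decide)
        (by simp only [hsum, Pi.add_apply, ya, yb, yc, yd, za, zb, zc, zd]; decide))
  have h := hC.ten_le_norm_add f hf (C.add_mem (C.add_mem hx hy) hz) hbS
    (by rw [Pi.add_apply, Pi.add_apply, xb, yb, zb]; rfl) hmem
  rw [add_self_zmod_two, hammingNorm_zero, hsum] at h
  split_ifs at h <;> omega

lemma exists_isCode_thirteen {C : Submodule (ZMod 2) (Fin 31 → ZMod 2)}
    (hr : Module.finrank (ZMod 2) C = 13) (hC : ∀ v ∈ C, v ≠ 0 → 10 ≤ hammingNorm v) :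
    ∃ D : Submodule (ZMod 2) (Fin 31 → ZMod 2), IsCode D 13 := by
  obtain ⟨s, hs⟩ : ∃ s : (Fin 31 → ZMod 2) →ₗ[ZMod 2] ZMod 2, ∀ v, s v = ∑ i, v i :=
    ⟨∑ i, LinearMap.proj i, fun v => by simp⟩
  obtain ⟨φ, hφ⟩ : ∃ φ : (Fin 31 → ZMod 2) →ₗ[ZMod 2] (Fin 31 → ZMod 2),
      ∀ v, φ v = v + s v • Pi.single 0 1 :=
    ⟨LinearMap.id + s.smulRight (Pi.single 0 1), fun _ => rfl⟩
  have heven : ∀ v, Even (hammingNorm (φ v)) := by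
    intro v
    rw [even_norm_iff, ← hs, hφ, map_add, map_smul]
    have : s (Pi.single 0 1) = 1 := by simp [hs]
    rw [this, smul_eq_mul, mul_one, CharTwo.add_self_eq_zero]
  have hten : ∀ v ∈ C, v ≠ 0 → 10 ≤ hammingNorm (φ v) := by
    intro v hv hv0
    have h1 := hC v hv hv0
    have h2 := norm_add_add (φ v) (s v • Pi.single 0 1)
    have h3 : φ v + s v • Pi.single 0 1 = v := by
      rw [hφ, add_assoc, add_self_zmod_two, add_zero]
    have h4 : hammingNorm (s v • Pi.single 0 1 : Fin 31 → ZMod 2) ≤ 1 := by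
      rcases zmod_two_cases (s v) with h | h <;> rw [h]
      · simp
      · decide
    rw [h3] at h2
    obtain ⟨r, hr⟩ := heven v
    omega
  have hinj : Function.Injective (φ ∘ₗ C.subtype) := by
    rw [injective_iff_map_eq_zero]
    intro v hv
    by_contra hv0
    have := hten v v.2 (by simpa using hv0)
    have h : φ v = 0 := hv
    rw [h] at this
    simp at this
  refine ⟨LinearMap.range (φ ∘ₗ C.subtype), by rw [LinearMap.finrank_range_of_inj hinj, hr], ?_, ?_⟩
  · rintro _ ⟨v, rfl⟩ hv
    refine hten v v.2 ?_
    rintro h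
    refine hv ?_
    change φ v = 0
    rw [h, map_zero]
  · rintro _ ⟨v, rfl⟩
    exact heven v

end BinaryCode

open BinaryCode in
/-- There is no binary linear code of length 31, dimension 13,
and minimum distance at least 10. -/
theorem no_code_31_13_10 :
    ¬ ∃ C : Submodule (ZMod 2) (Fin 31 → ZMod 2),
      Module.finrank (ZMod 2) C = 13 ∧
      ∀ v ∈ C, v ≠ 0 → 10 ≤ hammingNorm v := by
  rintro ⟨C, hr, hC⟩
  obtain ⟨D, hD⟩ := exists_isCode_thirteen hr hC
  obtain ⟨S, h1, h6, hd⟩ := hD.exists_dual_card_le_six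
  obtain ⟨E, hE⟩ := hD.exists_shorten (m := 25) (l := 8) (Finset.card_pos.1 h1) hd 6 h6 rfl
    (by norm_num)
  exact not_isCode_twentyfive_eight E hE
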